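/- arXiv:2007.08731 — 2 statements merged into one kernel-verified Lean document; each statement's English description precedes it below -/
import Mathlib

section
/- Let k be a field of characteristic zero, V a vector superspace over k, and x an odd endomorphism of V. Suppose there exist an even endomorphism h and an odd endomorphism Y of V with h∘x − x∘h = −2x, h∘Y − Y∘h = 2Y, and Y∘x + x∘Y = h. Then x is nilpotent and the pair (V, x) is neat. [Converse of the super Jacobson–Morozov lemma: a representation of osp(1|2) restricts to a neat action of its maximal nilpotent subalgebra.] -/
open scoped TensorProduct

section Defs

variable (k : Type*) [Field k]

def IsEvenMap {V : Type*} [AddCommGroup V] [Module k V]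
    (V0 V1 : Submodule k V) (f : V →ₗ[k] V) : Prop :=
  (∀ v ∈ V0, f v ∈ V0) ∧ (∀ v ∈ V1, f v ∈ V1)

def IsOddMap {V : Type*} [AddCommGroup V] [Module k V]
    (V0 V1 : Submodule k V) (f : V →ₗ[k] V) : Prop :=
  (∀ v ∈ V0, f v ∈ V1) ∧ (∀ v ∈ V1, f v ∈ V0)

/-- The shift endomorphism of the string module `M_n`: sends basis vector `a_j` to `a_{j+1}`,
and `a_n` to `0`.  In coordinates, `(x f) j = f (j-1)` for `j ≥ 1` and `(x f) 0 = 0`. -/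
def shiftMap (n : ℕ) : (Fin (n+1) → k) →ₗ[k] (Fin (n+1) → k) where
  toFun f := fun j =>
    if (j : ℕ) = 0 then 0 else f ⟨(j : ℕ) - 1, Nat.lt_of_le_of_lt (Nat.sub_le _ _) j.isLt⟩
  map_add' f g := by funext j; by_cases h : (j : ℕ) = 0 <;> simp only [Pi.add_apply, h, if_true, if_false, add_zero]
  map_smul' c f := by funext j; by_cases h : (j : ℕ) = 0 <;> simp only [Pi.smul_apply, RingHom.id_apply, h, if_true, if_false, smul_zero]

/-- The even (`r = 0`) resp. odd (`r = 1`) part of the string module `Π^ε M_n`: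
coordinates `j` with `(j + ε) % 2 = r`. -/
def stringPart (n ε r : ℕ) : Submodule k (Fin (n+1) → k) :=
  Submodule.pi Set.univ (fun j => if ((j : ℕ) + ε) % 2 = r then (⊤ : Submodule k k) else ⊥)

/-- Isomorphism of pairs (vector superspace with endomorphism): an even linear isomorphism
intertwining the endomorphisms. -/
def PairIso {V : Type*} [AddCommGroup V] [Module k V]
    (V0 V1 : Submodule k V) (x : V →ₗ[k] V)
    {W : Type*} [AddCommGroup W] [Module k W]
    (W0 W1 : Submodule k W) (y : W →ₗ[k] W) : Prop :=
  ∃ φ : V ≃ₗ[k] W, (∀ v ∈ V0, φ v ∈ W0) ∧ (∀ v ∈ V1, φ v ∈ W1) ∧ ∀ v, φ (x v) = y (φ v)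

/-- `V` decomposes as a direct sum of `x`-invariant graded subspaces, each isomorphic as a pair
to some `Π^ε M_n` with `P n`. -/
def DecomposesIntoStrings {V : Type*} [AddCommGroup V] [Module k V]
    (V0 V1 : Submodule k V) (x : V →ₗ[k] V) (P : ℕ → Prop) : Prop :=
  ∃ (m : ℕ) (U : Fin m → Submodule k V), DirectSum.IsInternal U ∧
    ∀ i : Fin m, (U i = (U i ⊓ V0) ⊔ (U i ⊓ V1)) ∧
      ∃ (hx : ∀ v ∈ U i, x v ∈ U i) (n ε : ℕ), ε ≤ 1 ∧ P n ∧
        PairIso k (V0.comap (U i).subtype) (V1.comap (U i).subtype) (x.restrict hx)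
          (stringPart k n ε 0) (stringPart k n ε 1) (shiftMap k n)

/-- A pair `(V, x)` (odd nilpotent `x`) is neat if it decomposes into strings `Π^ε M_{2s}`. -/
def IsNeat {V : Type*} [AddCommGroup V] [Module k V]
    (V0 V1 : Submodule k V) (x : V →ₗ[k] V) : Prop :=
  DecomposesIntoStrings k V0 V1 x (fun n => Even n)

end Defs

structure OspT {k V : Type*} [Field k] [AddCommGroup V] [Module k V]
    (x h Y : V →ₗ[k] V) : Prop where
  h1 : ∀ v, h (x v) = x (h v) - (2 : k) • x v
  h2 : ∀ v, h (Y v) = Y (h v) + (2 : k) • Y v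
  h3 : ∀ v, Y (x v) + x (Y v) = h v

namespace OspT
variable {k V : Type*} [Field k] [AddCommGroup V] [Module k V] {x h Y : V →ₗ[k] V}

theorem symm (T : OspT x h Y) : OspT Y (-h) (-x) where
  h1 v := by simp only [LinearMap.neg_apply, T.h2, map_neg]; abel
  h2 v := by simp only [LinearMap.neg_apply, T.h1, map_neg, smul_neg]; abel
  h3 v := by simp only [LinearMap.neg_apply, ← T.h3, map_neg]; abel

theorem h_pow (T : OspT x h Y) (n : ℕ) (v : V) :
    h ((x ^ n) v) = (x ^ n) (h v) - (2 * n : k) • (x ^ n) v := by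
  induction n generalizing v with
  | zero => simp
  | succ n ih =>
    rw [pow_succ, Module.End.mul_apply, ih, T.h1, map_sub, map_smul, Module.End.mul_apply]
    push_cast
    module

theorem nilp [CharZero k] [FiniteDimensional k V] (T : OspT x h Y) : IsNilpotent x := by
  by_contra hn
  let ad : Module.End k (Module.End k V) :=
    LinearMap.mulLeft k h - LinearMap.mulRight k h
  have hev : ∀ n : ℕ, ad.HasEigenvalue (-(2 * n : k)) := by
    intro n
    refine Module.End.hasEigenvalue_of_hasEigenvector (x := x ^ n) ⟨?_, ?_⟩
    · rw [Module.End.mem_eigenspace_iff]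
      ext v
      simp [ad, T.h_pow n v]
    · intro h0
      exact hn ⟨n, h0⟩
  have hfin := Module.End.finite_hasEigenvalue ad
  refine Set.infinite_of_injective_forall_mem (f := fun n : ℕ => (-(2 * n : k))) ?_ hev hfin
  intro a b hab
  simpa using hab

theorem Y_even_odd (T : OspT x h Y) (j : ℕ) (w : V) (hw : Y w = 0) :
    Y ((x ^ (2 * j)) w) = -(2 * j : k) • (x ^ (2 * j - 1)) w ∧
    Y ((x ^ (2 * j + 1)) w) = (x ^ (2 * j)) (h w - (2 * j : k) • w) := by
  have odd : ∀ j : ℕ, Y ((x ^ (2 * j)) w) = -(2 * j : k) • (x ^ (2 * j - 1)) w →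
      Y ((x ^ (2 * j + 1)) w) = (x ^ (2 * j)) (h w - (2 * j : k) • w) := by
    intro j hj
    have e := T.h3 ((x ^ (2 * j)) w)
    rw [pow_succ', Module.End.mul_apply, eq_sub_of_add_eq e, hj, T.h_pow, map_smul, map_sub,
      map_smul]
    rcases j with _ | j
    · simp
    · rw [← Module.End.mul_apply x, ← pow_succ']
      have : 2 * (j + 1) - 1 + 1 = 2 * (j + 1) := by omega
      rw [this]
      push_cast
      module
  suffices hj : Y ((x ^ (2 * j)) w) = -(2 * j : k) • (x ^ (2 * j - 1)) w from ⟨hj, odd j hj⟩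
  induction j with
  | zero => simp [hw]
  | succ j ih =>
    have e := T.h3 ((x ^ (2 * j + 1)) w)
    have e2 : 2 * (j + 1) = 2 * j + 1 + 1 := by ring
    have e3 : 2 * (j + 1) - 1 = 2 * j + 1 := by omega
    rw [e3, e2, pow_succ', Module.End.mul_apply, eq_sub_of_add_eq e, odd j ih, T.h_pow,
      ← Module.End.mul_apply x, ← pow_succ', map_sub, map_smul]
    push_cast
    module

/-- Highest weight vectors. -/
theorem hw_string [CharZero k] [FiniteDimensional k V] (T : OspT x h Y) (w : V) (hw : Y w = 0)
    (w0 : w ≠ 0) (μ : k) (hμ : h w = μ • w) :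
    ∃ s : ℕ, μ = 2 * s ∧ (x ^ (2 * s + 1)) w = 0 := by
  classical
  obtain ⟨N, hN⟩ := T.nilp
  have hex : ∃ n, (x ^ n) w = 0 := ⟨N, by simp [hN]⟩
  obtain ⟨n, hn, hmin⟩ : ∃ n, (x ^ n) w = 0 ∧ ∀ m < n, (x ^ m) w ≠ 0 :=
    ⟨Nat.find hex, Nat.find_spec hex, fun m hm => Nat.find_min hex hm⟩
  rcases Nat.even_or_odd' n with ⟨j, rfl | rfl⟩
  · exfalso
    have e := (T.Y_even_odd j w hw).1
    rcases j with _ | j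
    · simp at hn; exact w0 hn
    rw [hn, map_zero] at e
    have := hmin (2 * (j + 1) - 1) (by omega)
    rcases smul_eq_zero.1 e.symm with h' | h'
    · have : (j : k) + 1 ≠ 0 := by exact_mod_cast Nat.succ_ne_zero j
      simp at h'; exact this h'
    · exact this h'
  · refine ⟨j, ?_, hn⟩
    have e := (T.Y_even_odd j w hw).2
    rw [hn, map_zero, hμ, ← sub_smul, map_smul] at e
    rcases smul_eq_zero.1 e.symm with h' | h'
    · exact sub_eq_zero.1 h'
    · exact absurd h' (hmin _ (by omega))

theorem mem_span_eig [CharZero k] (T : OspT x h Y) (G : Submodule k V)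
    (hG : ∀ v ∈ G, h v ∈ G) (hGY : ∀ v ∈ G, Y v = 0) (N : ℕ) :
    ∀ w ∈ G, (x ^ (2 * N)) w = 0 →
      w ∈ Submodule.span k {v | v ∈ G ∧ ∃ j < N, h v = (2 * j : k) • v} := by
  induction N with
  | zero => intro w _ h0; simp at h0; simp [h0]
  | succ N ih =>
    intro w hw h0
    have a1 : (x ^ (2 * N + 1)) w = 0 := by
      have e := (T.Y_even_odd (N + 1) w (hGY w hw)).1
      rw [h0, map_zero] at e
      rcases smul_eq_zero.1 e.symm with h' | h'
      · have : (N : k) + 1 ≠ 0 := by exact_mod_cast Nat.succ_ne_zero N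
        simp at h'; exact absurd h' this
      · exact h'
    have a2 : (x ^ (2 * N)) (h w - (2 * N : k) • w) = 0 := by
      have e := (T.Y_even_odd N w (hGY w hw)).2
      rw [a1, map_zero] at e
      exact e.symm
    have a3 := ih _ (G.sub_mem (hG w hw) (G.smul_mem _ hw)) a2
    have key : ∀ z ∈ Submodule.span k {v | v ∈ G ∧ ∃ j < N, h v = (2 * j : k) • v},
        ∃ u ∈ Submodule.span k {v | v ∈ G ∧ ∃ j < N, h v = (2 * j : k) • v},
          h u - (2 * N : k) • u = z := by
      intro z hz
      induction hz using Submodule.span_induction with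
      | mem z hz =>
        obtain ⟨hzG, j, hj, hzj⟩ := id hz
        have hne : (2 * j - 2 * N : k) ≠ 0 := by
          rw [← mul_sub]
          refine mul_ne_zero two_ne_zero (sub_ne_zero.2 ?_)
          exact_mod_cast hj.ne
        refine ⟨(2 * j - 2 * N : k)⁻¹ • z, Submodule.smul_mem _ _ (Submodule.subset_span hz), ?_⟩
        rw [map_smul, hzj, smul_comm _ (_⁻¹) z, ← smul_sub, ← sub_smul, smul_smul,
          inv_mul_cancel₀ hne, one_smul]
      | zero => exact ⟨0, Submodule.zero_mem _, by simp⟩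
      | add a b _ _ ha hb =>
        obtain ⟨u, hu, rfl⟩ := ha
        obtain ⟨u', hu', rfl⟩ := hb
        exact ⟨u + u', Submodule.add_mem _ hu hu', by rw [map_add]; module⟩
      | smul c a _ ha =>
        obtain ⟨u, hu, rfl⟩ := ha
        exact ⟨c • u, Submodule.smul_mem _ _ hu, by rw [map_smul]; module⟩
    obtain ⟨u, hu, hue⟩ := key _ a3
    have huG : u ∈ G := (Submodule.span_le.2 (fun v hv => hv.1)) hu
    have hmono : Submodule.span k {v | v ∈ G ∧ ∃ j < N, h v = (2 * j : k) • v} ≤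
        Submodule.span k {v | v ∈ G ∧ ∃ j < N + 1, h v = (2 * j : k) • v} :=
      Submodule.span_mono (fun v hv => ⟨hv.1, by
        obtain ⟨j, hj, e⟩ := hv.2; exact ⟨j, by omega, e⟩⟩)
    rw [← sub_add_cancel w u]
    refine Submodule.add_mem _ (Submodule.subset_span ⟨G.sub_mem hw huG, N, by omega, ?_⟩)
      (hmono hu)
    rw [map_sub, smul_sub, sub_eq_sub_iff_sub_eq_sub, hue]

theorem mem_span_eig' [CharZero k] [FiniteDimensional k V] (T : OspT x h Y) (G : Submodule k V)
    (hG : ∀ v ∈ G, h v ∈ G) (hGY : ∀ v ∈ G, Y v = 0) :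
    ∀ w ∈ G, w ∈ Submodule.span k {v | v ∈ G ∧ ∃ j : ℕ, h v = (2 * j : k) • v} := by
  intro w hw
  obtain ⟨N, hN⟩ := T.nilp
  refine Submodule.span_mono ?_ (T.mem_span_eig G hG hGY N w hw ?_)
  · rintro v ⟨h1, j, _, h2⟩
    exact ⟨h1, j, h2⟩
  · rw [two_mul, pow_add, hN]; simp

/-- The operator `xY - Yx - 1` anticommutes with `Y`. -/
theorem Q_pow (T : OspT x h Y) (c : k) (v : V) (hv : x (Y v) - Y (x v) - v = c • v) (m : ℕ) :
    x (Y ((Y ^ m) v)) - Y (x ((Y ^ m) v)) - (Y ^ m) v = ((-1) ^ m * c) • (Y ^ m) v := by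
  induction m with
  | zero => simpa using hv
  | succ m ih =>
    rw [pow_succ', Module.End.mul_apply]
    set u := (Y ^ m) v
    have e1 := T.h3 (Y u)
    have e2 := T.h3 u
    have e3 := T.h2 u
    have e4 := congrArg Y ih
    have e5 := congrArg Y e2
    simp only [map_sub, map_add, map_smul] at e4 e5
    have e0 : (-1 : k) ^ (m + 1) * c = -((-1) ^ m * c) := by ring
    rw [e0, neg_smul, ← e4]
    have e6 : x (Y (Y u)) = h (Y u) - Y (x (Y u)) := by rw [← e1]; abel
    rw [e6, e3, ← e5, two_smul]
    abel

theorem disj [CharZero k] [FiniteDimensional k V] (T : OspT x h Y) :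
    Disjoint (LinearMap.ker Y) (LinearMap.range x) := by
  rw [Submodule.disjoint_def]
  intro w hw hwx
  let G := LinearMap.ker Y ⊓ LinearMap.range x
  have hG : ∀ v ∈ G, h v ∈ G := by
    rintro v ⟨h1, ⟨u, rfl⟩⟩
    replace h1 : Y (x u) = 0 := h1
    refine ⟨?_, ⟨h u - (2 : k) • u, by rw [T.h1, map_sub, map_smul]⟩⟩
    have := T.h2 (x u)
    simp only [h1, map_zero, smul_zero, add_zero] at this
    exact this.symm
  have hGY : ∀ v ∈ G, Y v = 0 := fun v hv => hv.1
  have hs := T.mem_span_eig' G hG hGY w ⟨hw, hwx⟩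
  suffices hz : {v | v ∈ G ∧ ∃ j : ℕ, h v = (2 * j : k) • v} ⊆ {0} by
    have := Submodule.span_mono (R := k) hz hs
    simpa using this
  rintro w ⟨⟨hw, ⟨v, rfl⟩⟩, s, hs⟩
  replace hw : Y (x v) = 0 := hw
  by_contra hne
  simp only [Set.mem_singleton_iff] at hne
  -- adjust v to be an eigenvector
  have hker : ∀ u ∈ LinearMap.ker x, (h - (2 * s + 2 : k) • (LinearMap.id : V →ₗ[k] V)) u ∈ LinearMap.ker x := by
    intro u hu
    simp only [LinearMap.mem_ker] at hu ⊢
    have := T.h1 u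
    simp only [hu, map_zero, smul_zero, sub_zero] at this
    simp [hu, ← this]
  have hinj : Function.Injective ((h - (2 * s + 2 : k) • (LinearMap.id : V →ₗ[k] V)).restrict hker) := by
    rw [injective_iff_map_eq_zero]
    rintro ⟨u, hu⟩ h0
    have h0' := congrArg Subtype.val h0
    simp only [LinearMap.restrict_apply, LinearMap.sub_apply, LinearMap.smul_apply,
      LinearMap.id_apply, ZeroMemClass.coe_zero, sub_eq_zero] at h0'
    by_contra hu0
    have hu1 : u ≠ 0 := fun e => hu0 (Subtype.ext e)
    simp only [LinearMap.mem_ker] at hu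
    obtain ⟨t, ht, -⟩ := T.symm.hw_string u (by simp [hu]) hu1 (-(2 * s + 2)) (by
      rw [LinearMap.neg_apply, h0', neg_smul])
    have : ((2 * s + 2 + 2 * t : ℕ) : k) = 0 := by push_cast; linear_combination -ht
    rw [Nat.cast_eq_zero] at this
    omega
  have hsurj := LinearMap.injective_iff_surjective.1 hinj
  have hu : h v - (2 * s + 2 : k) • v ∈ LinearMap.ker x := by
    rw [LinearMap.mem_ker, map_sub, map_smul]
    have := T.h1 v
    rw [hs] at this
    rw [eq_add_of_sub_eq this.symm]
    module
  obtain ⟨⟨u, hux⟩, hu2⟩ := hsurj ⟨_, hu⟩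
  have hu2' := congrArg Subtype.val hu2
  simp only [LinearMap.restrict_apply, LinearMap.sub_apply, LinearMap.smul_apply,
      LinearMap.id_apply] at hu2'
  simp only [LinearMap.mem_ker] at hux
  obtain ⟨v', hv', hev⟩ : ∃ v', x v' = x v ∧ h v' = (2 * s + 2 : k) • v' := by
    refine ⟨v - u, by simp [hux], ?_⟩
    rw [map_sub, smul_sub, sub_eq_sub_iff_sub_eq_sub, ← hu2']
  rw [← hv'] at hw hne
  have hv0 : v' ≠ 0 := by rintro rfl; simp at hne
  have hQ : x (Y v') - Y (x v') - v' = (2 * s + 1 : k) • v' := by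
    have e := T.h3 v'
    rw [hw, zero_add, hev] at e
    rw [hw, e]; module
  classical
  obtain ⟨N, hN⟩ := T.symm.nilp
  have hex : ∃ n, (Y ^ n) v' = 0 := ⟨N, by simp [hN]⟩
  obtain ⟨n, hn, hmin⟩ : ∃ n, (Y ^ n) v' = 0 ∧ ∀ m < n, (Y ^ m) v' ≠ 0 :=
    ⟨Nat.find hex, Nat.find_spec hex, fun m hm => Nat.find_min hex hm⟩
  rcases n with _ | m
  · exact hv0 (by simpa using hn)
  have hz := hmin m (by omega)
  rw [pow_succ', Module.End.mul_apply] at hn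
  have eQ := T.Q_pow _ v' hQ m
  have eh := T.symm.h_pow m v'
  have e3 := T.h3 ((Y ^ m) v')
  simp only [LinearMap.neg_apply, hev, map_neg, map_smul] at eh
  rw [hn, map_zero, add_zero] at e3
  rw [hn, map_zero, zero_sub, e3, ] at eQ
  have e4 : h ((Y ^ m) v') = (2 * s + 2 + 2 * m : k) • (Y ^ m) v' := by
    rw [← neg_neg (h _), eh]; module
  rw [e4] at eQ
  have e5 : ((2 * s + 2 + 2 * m : k) + 1 + ((-1) ^ m * (2 * s + 1))) • (Y ^ m) v' = 0 := by
    rw [add_smul _ (_ * _), ← eQ]; module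
  rcases smul_eq_zero.1 e5 with e6 | e6
  · rcases neg_one_pow_eq_or k m with e7 | e7
    · rw [e7] at e6
      have : ((2 * s + 2 + 2 * m + 1 + 2 * s + 1 : ℕ) : k) = 0 := by
        push_cast; linear_combination e6
      rw [Nat.cast_eq_zero] at this
      omega
    · rw [e7] at e6
      have : ((2 * m + 2 : ℕ) : k) = 0 := by
        push_cast; linear_combination e6
      rw [Nat.cast_eq_zero] at this
      omega
  · exact hz e6

theorem sup_top [CharZero k] [FiniteDimensional k V] (T : OspT x h Y) :
    LinearMap.ker Y ⊔ LinearMap.range x = ⊤ := by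
  have d1 := T.disj
  have d2 := T.symm.disj
  have hk : LinearMap.ker (-x) = LinearMap.ker x := by ext v; simp
  rw [hk] at d2
  have a1 := Submodule.finrank_add_finrank_le_of_disjoint d2
  have a2 := LinearMap.finrank_range_add_finrank_ker x
  have a3 := LinearMap.finrank_range_add_finrank_ker Y
  exact Submodule.eq_top_of_disjoint _ _ (by omega) d1

end OspT

namespace OspT
variable {k V : Type*} [Field k] [AddCommGroup V] [Module k V] {x h Y : V →ₗ[k] V}

theorem Y_step [CharZero k] (T : OspT x h Y) (w : V) (hw : Y w = 0) (s : ℕ)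
    (hs : h w = (2 * s : k) • w) (j : ℕ) (hj : j + 1 ≤ 2 * s) :
    ∃ c : k, c ≠ 0 ∧ Y ((x ^ (j + 1)) w) = c • (x ^ j) w := by
  rcases Nat.even_or_odd' j with ⟨i, rfl | rfl⟩
  · refine ⟨2 * s - 2 * i, ?_, ?_⟩
    · rw [← mul_sub]
      refine mul_ne_zero two_ne_zero (sub_ne_zero.2 ?_)
      have : s ≠ i := by omega
      exact_mod_cast this
    · rw [(T.Y_even_odd i w hw).2, hs, ← sub_smul, map_smul]
  · refine ⟨-(2 * (i + 1 : ℕ)), ?_, ?_⟩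
    · rw [neg_ne_zero]
      exact mul_ne_zero two_ne_zero (by exact_mod_cast Nat.succ_ne_zero i)
    · exact (T.Y_even_odd (i + 1) w hw).1

theorem Y_pow [CharZero k] (T : OspT x h Y) (w : V) (hw : Y w = 0) (s : ℕ)
    (hs : h w = (2 * s : k) • w) (j : ℕ) (hj : j ≤ 2 * s) :
    ∃ c : k, c ≠ 0 ∧ (Y ^ j) ((x ^ j) w) = c • w := by
  induction j with
  | zero => exact ⟨1, one_ne_zero, by simp⟩
  | succ j ih =>
    obtain ⟨c, hc, e⟩ := ih (by omega)
    obtain ⟨d, hd, e'⟩ := T.Y_step w hw s hs j hj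
    refine ⟨d * c, mul_ne_zero hd hc, ?_⟩
    rw [pow_succ Y, Module.End.mul_apply, e', map_smul, e, smul_smul]

theorem Y_pow_zero [CharZero k] (T : OspT x h Y) (w : V) (hw : Y w = 0) (s : ℕ)
    (hs : h w = (2 * s : k) • w) (j : ℕ) (hj : j ≤ 2 * s) (n : ℕ) (hn : j < n) :
    (Y ^ n) ((x ^ j) w) = 0 := by
  obtain ⟨c, hc, e⟩ := T.Y_pow w hw s hs j hj
  obtain ⟨m, rfl⟩ : ∃ m, n = m + 1 + j := ⟨n - j - 1, by omega⟩
  rw [pow_add, Module.End.mul_apply, e, map_smul, pow_succ, Module.End.mul_apply, hw]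
  simp

theorem indep_aux [CharZero k] (T : OspT x h Y) {ι : Type*} [Fintype ι] (e : ι → V)
    (he : LinearIndependent k e) (hY : ∀ i, Y (e i) = 0) (s : ι → ℕ)
    (hs : ∀ i, h (e i) = (2 * s i : k) • e i) (c : ι → ℕ → k)
    (hc : ∀ i j, 2 * s i < j → c i j = 0) (n : ℕ)
    (h0 : ∑ i, ∑ j ∈ Finset.range n, c i j • (x ^ j) (e i) = 0) :
    ∀ i, ∀ j < n, c i j = 0 := by
  induction n with
  | zero => intro i j hj; omega
  | succ n ih =>
    have hn : ∀ i, c i n = 0 := by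
      have e1 := congrArg (Y ^ n) h0
      have hd : ∀ i, ∃ d : k, c i n • (Y ^ n) ((x ^ n) (e i)) = (c i n * d) • e i ∧ d ≠ 0 := by
        intro i
        by_cases hi : n ≤ 2 * s i
        · obtain ⟨d, hd, e⟩ := T.Y_pow (e i) (hY i) (s i) (hs i) n hi
          exact ⟨d, by rw [e, smul_smul], hd⟩
        · exact ⟨1, by simp [hc i n (by omega)], one_ne_zero⟩
      choose d hd hd0 using hd
      have e2 : ∑ i, (c i n * d i) • e i = 0 := by
        rw [← map_zero (Y ^ n), ← h0, map_sum]
        refine Finset.sum_congr rfl fun i _ => ?_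
        rw [map_sum, Finset.sum_range_succ, Finset.sum_eq_zero, zero_add, map_smul, hd]
        intro j hj
        rw [map_smul]
        by_cases hi : j ≤ 2 * s i
        · rw [T.Y_pow_zero (e i) (hY i) (s i) (hs i) j hi n (Finset.mem_range.1 hj), smul_zero]
        · rw [hc i j (by omega), zero_smul]
      intro i
      have := Fintype.linearIndependent_iff.1 he _ e2 i
      exact (mul_eq_zero.1 this).resolve_right (hd0 i)
    have ih' := ih (by
      rw [← h0]
      refine Finset.sum_congr rfl fun i _ => ?_
      rw [Finset.sum_range_succ, hn, zero_smul, add_zero])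
    intro i j hj
    rcases Nat.lt_succ_iff_lt_or_eq.1 hj with h' | rfl
    · exact ih' i j h'
    · exact hn i

theorem indep [CharZero k] (T : OspT x h Y) {ι : Type*} [Fintype ι] (e : ι → V)
    (he : LinearIndependent k e) (hY : ∀ i, Y (e i) = 0) (s : ι → ℕ)
    (hs : ∀ i, h (e i) = (2 * s i : k) • e i) :
    LinearIndependent k (fun p : Σ i, Fin (2 * s i + 1) => (x ^ (p.2 : ℕ)) (e p.1)) := by
  rw [Fintype.linearIndependent_iff]
  intro g hg
  let c : ι → ℕ → k := fun i j => if hj : j < 2 * s i + 1 then g ⟨i, ⟨j, hj⟩⟩ else 0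
  let N := (∑ i, 2 * s i) + 1
  have hN : ∀ i, 2 * s i + 1 ≤ N := fun i =>
    Nat.succ_le_succ (Finset.single_le_sum (f := fun i => 2 * s i) (fun _ _ => Nat.zero_le _)
      (Finset.mem_univ i))
  have key := T.indep_aux e he hY s hs c (fun i j hj => dif_neg (by omega)) N (by
    rw [← hg, Fintype.sum_sigma]
    refine Finset.sum_congr rfl fun i _ => ?_
    rw [← Finset.sum_subset (Finset.range_mono (hN i)), Finset.sum_range]
    · refine Finset.sum_congr rfl fun j _ => ?_
      rw [show c i j = g ⟨i, j⟩ from dif_pos j.2]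
    · intro j _ hj
      simp only [Finset.mem_range, not_lt] at hj
      rw [show c i j = 0 from dif_neg (by omega), zero_smul])
  rintro ⟨i, j⟩
  have := key i j (lt_of_lt_of_le j.2 (hN i))
  rwa [show c i j = g ⟨i, j⟩ from dif_pos j.2] at this

end OspT

theorem even_or_odd_pow {k V : Type*} [Field k] [AddCommGroup V] [Module k V]
    {V0 V1 : Submodule k V} {x : V →ₗ[k] V} (hodd : IsOddMap k V0 V1 x) (w : V) (ε : ℕ)
    (h0 : ε = 0 → w ∈ V0) (h1 : ε = 1 → w ∈ V1) (hε : ε ≤ 1) (j : ℕ) :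
    ((j + ε) % 2 = 0 → (x ^ j) w ∈ V0) ∧ ((j + ε) % 2 = 1 → (x ^ j) w ∈ V1) := by
  induction j with
  | zero =>
    exact ⟨fun h => by simpa using h0 (by omega), fun h => by simpa using h1 (by omega)⟩
  | succ j ih =>
    rw [pow_succ', Module.End.mul_apply]
    exact ⟨fun h => hodd.2 _ (ih.2 (by omega)), fun h => hodd.1 _ (ih.1 (by omega))⟩

/-- A single string. -/
theorem string_pair {k V : Type*} [Field k] [AddCommGroup V] [Module k V]
    {V0 V1 : Submodule k V} (hcompl : IsCompl V0 V1) {x : V →ₗ[k] V}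
    (hodd : IsOddMap k V0 V1 x) (w : V) (ε : ℕ)
    (h0 : ε = 0 → w ∈ V0) (h1 : ε = 1 → w ∈ V1) (hε : ε ≤ 1) (n : ℕ)
    (hn : (x ^ (n + 1)) w = 0)
    (hli : LinearIndependent k (fun j : Fin (n + 1) => (x ^ (j : ℕ)) w))
    (U : Submodule k V) (hU : U = Submodule.span k (Set.range fun j : Fin (n + 1) => (x ^ (j : ℕ)) w))
    (hP : Even n) :
    (U = (U ⊓ V0) ⊔ (U ⊓ V1)) ∧
      ∃ (hx : ∀ v ∈ U, x v ∈ U) (n ε : ℕ), ε ≤ 1 ∧ Even n ∧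
        PairIso k (V0.comap U.subtype) (V1.comap U.subtype) (x.restrict hx)
          (stringPart k n ε 0) (stringPart k n ε 1) (shiftMap k n) := by
  have hpar := even_or_odd_pow hodd w ε h0 h1 hε
  have hmem : ∀ j : Fin (n + 1), (x ^ (j : ℕ)) w ∈ U := fun j => by
    rw [hU]; exact Submodule.subset_span ⟨j, rfl⟩
  have hmem' : ∀ j : ℕ, (x ^ j) w ∈ U := fun j => by
    by_cases hj : j < n + 1
    · exact hmem ⟨j, hj⟩
    · obtain ⟨m, rfl⟩ : ∃ m, j = m + (n + 1) := ⟨j - (n + 1), by omega⟩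
      rw [pow_add, Module.End.mul_apply, hn, map_zero]
      exact U.zero_mem
  have hx : ∀ v ∈ U, x v ∈ U := by
    have : U ≤ U.comap x := by
      conv_lhs => rw [hU]
      rw [Submodule.span_le]
      rintro _ ⟨j, rfl⟩
      have := hmem' (j + 1)
      rwa [pow_succ', Module.End.mul_apply] at this
    exact this
  refine ⟨le_antisymm ?_ (sup_le inf_le_left inf_le_left), hx, n, ε, hε, hP, ?_⟩
  · conv_lhs => rw [hU]
    rw [Submodule.span_le]
    rintro _ ⟨j, rfl⟩
    rcases Nat.mod_two_eq_zero_or_one (j + ε) with hj | hj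
    · exact Submodule.mem_sup_left ⟨hmem j, (hpar j).1 hj⟩
    · exact Submodule.mem_sup_right ⟨hmem j, (hpar j).2 hj⟩
  · let B : Module.Basis (Fin (n + 1)) k U :=
      (Module.Basis.span hli).map (LinearEquiv.ofEq _ _ hU.symm)
    have hB : ∀ j, (B j : V) = (x ^ (j : ℕ)) w := fun j => by
      simp [B, Module.Basis.span_apply]
    have hsum : ∀ v : U, ∑ j, B.equivFun v j • (x ^ (j : ℕ)) w = (v : V) := fun v => by
      have := congrArg Subtype.val (B.sum_equivFun v)
      rw [← this, Submodule.coe_sum]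
      simp only [Submodule.coe_smul, hB]
    -- the coordinates of the wrong parity vanish
    have main : ∀ (A A' : Submodule k V), Disjoint A A' → ∀ r : ℕ,
        (∀ j : ℕ, (j + ε) % 2 = r → (x ^ j) w ∈ A) →
        (∀ j : ℕ, (j + ε) % 2 ≠ r → (x ^ j) w ∈ A') →
        ∀ v : U, (v : V) ∈ A → B.equivFun v ∈ stringPart k n ε r := by
      intro A A' hA r hr hr' v hv
      have hz : ∑ j : Fin (n + 1), (if ((j : ℕ) + ε) % 2 = r then 0 else B.equivFun v j) • (x ^ (j : ℕ)) w
          = 0 := by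
        refine Submodule.disjoint_def.1 hA _ ?_ ?_
        · have e : ∑ j : Fin (n + 1), (if ((j : ℕ) + ε) % 2 = r then 0 else B.equivFun v j) • (x ^ (j : ℕ)) w
            = v - ∑ j : Fin (n + 1), (if ((j : ℕ) + ε) % 2 = r then B.equivFun v j else 0) • (x ^ (j : ℕ)) w := by
            rw [← hsum v, ← Finset.sum_sub_distrib]
            refine Finset.sum_congr rfl fun j _ => ?_
            split_ifs <;> simp
          rw [e]
          refine A.sub_mem hv (A.sum_mem fun j _ => ?_)
          split_ifs with hj
          · exact A.smul_mem _ (hr _ hj)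
          · simp
        · refine A'.sum_mem fun j _ => ?_
          split_ifs with hj
          · simp
          · exact A'.smul_mem _ (hr' _ hj)
      have hz' := Fintype.linearIndependent_iff.1 hli _ hz
      rw [stringPart, Submodule.mem_pi]
      intro j _
      have := hz' j
      split_ifs at this ⊢ with hj
      · trivial
      · exact this
    refine ⟨B.equivFun, ?_, ?_, ?_⟩
    · intro v hv
      exact main V0 V1 hcompl.disjoint 0 (fun j => (hpar j).1)
        (fun j hj => (hpar j).2 (by omega)) v hv
    · intro v hv
      exact main V1 V0 hcompl.disjoint.symm 1 (fun j => (hpar j).2)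
        (fun j hj => (hpar j).1 (by omega)) v hv
    · have : B.equivFun.toLinearMap ∘ₗ x.restrict hx = shiftMap k n ∘ₗ B.equivFun.toLinearMap := by
        refine B.ext fun j => ?_
        by_cases hj : (j : ℕ) + 1 < n + 1
        · have e : x.restrict hx (B j) = B ⟨j + 1, hj⟩ := by
            apply Subtype.ext
            rw [LinearMap.coe_restrict_apply, hB, hB, pow_succ', Module.End.mul_apply]
          simp only [LinearMap.comp_apply, LinearEquiv.coe_coe, e, Module.Basis.equivFun_self]
          funext i
          simp only [shiftMap, LinearMap.coe_mk, AddHom.coe_mk]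
          simp only [Module.Basis.equivFun_self, Fin.ext_iff]
          split_ifs <;> first | rfl | omega
        · have e : x.restrict hx (B j) = 0 := by
            apply Subtype.ext
            rw [LinearMap.coe_restrict_apply, hB, ← Module.End.mul_apply, ← pow_succ',
              show (j : ℕ) + 1 = n + 1 by omega, hn]
            rfl
          simp only [LinearMap.comp_apply, LinearEquiv.coe_coe, e, map_zero]
          funext i
          simp only [shiftMap, LinearMap.coe_mk, AddHom.coe_mk]
          simp only [Module.Basis.equivFun_self, Fin.ext_iff]
          split_ifs <;> first | rfl | omega
      exact fun v => LinearMap.congr_fun this v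

/-- **Converse of the super Jacobson–Morozov lemma**: if an odd endomorphism `x` of a vector
superspace `V` over a field of characteristic zero fits into an `osp(1|2)`-triple `(h, x, Y)`,
then `x` is nilpotent and `(V, x)` is neat. -/
theorem super_jacobson_morozov_converse {k : Type*} [Field k] [CharZero k]
    (V : Type*) [AddCommGroup V] [Module k V] [FiniteDimensional k V]
    (V0 V1 : Submodule k V) (hcompl : IsCompl V0 V1)
    (x : V →ₗ[k] V) (hodd : IsOddMap k V0 V1 x)
    (h Y : V →ₗ[k] V)
    (hheven : IsEvenMap k V0 V1 h) (hYodd : IsOddMap k V0 V1 Y)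
    (rel1 : h ∘ₗ x - x ∘ₗ h = -((2 : k) • x))
    (rel2 : h ∘ₗ Y - Y ∘ₗ h = (2 : k) • Y)
    (rel3 : Y ∘ₗ x + x ∘ₗ Y = h) :
    IsNilpotent x ∧ IsNeat k V0 V1 x := by
  have T : OspT x h Y := by
    refine ⟨fun v => ?_, fun v => ?_, fun v => ?_⟩
    · have := LinearMap.congr_fun rel1 v
      simp only [LinearMap.sub_apply, LinearMap.comp_apply, LinearMap.neg_apply,
        LinearMap.smul_apply] at this
      rw [eq_add_of_sub_eq this]; abel
    · have := LinearMap.congr_fun rel2 v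
      simp only [LinearMap.sub_apply, LinearMap.comp_apply,
        LinearMap.smul_apply] at this
      rw [eq_add_of_sub_eq this]; abel
    · exact LinearMap.congr_fun rel3 v
  refine ⟨T.nilp, ?_⟩
  -- homogeneous highest weight vectors
  let S : Set V := {v | (Y v = 0 ∧ ∃ j : ℕ, h v = (2 * j : k) • v) ∧ (v ∈ V0 ∨ v ∈ V1)}
  have hkerh : ∀ v ∈ LinearMap.ker Y, h v ∈ LinearMap.ker Y := by
    intro v hv
    rw [LinearMap.mem_ker] at hv ⊢
    have := T.h2 v
    simp only [hv, map_zero, smul_zero, add_zero] at this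
    exact this.symm
  have hS : LinearMap.ker Y ≤ Submodule.span k S := by
    intro w hw
    obtain ⟨w0, hw0, w1, hw1, rfl⟩ :=
      Submodule.mem_sup.1 (hcompl.sup_eq_top ▸ Submodule.mem_top : w ∈ V0 ⊔ V1)
    rw [LinearMap.mem_ker, map_add] at hw
    have y0 : Y w0 = 0 := by
      refine Submodule.disjoint_def.1 hcompl.disjoint _ ?_ (hYodd.1 _ hw0)
      rw [eq_neg_of_add_eq_zero_left hw]
      exact V0.neg_mem (hYodd.2 _ hw1)
    have y1 : Y w1 = 0 := by rwa [y0, zero_add] at hw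
    refine Submodule.add_mem _ ?_ ?_
    · refine Submodule.span_mono ?_ (T.mem_span_eig' (LinearMap.ker Y ⊓ V0)
        (fun v hv => ⟨hkerh v hv.1, hheven.1 v hv.2⟩) (fun v hv => hv.1) w0 ⟨y0, hw0⟩)
      rintro v ⟨hv, hj⟩
      exact ⟨⟨hv.1, hj⟩, Or.inl hv.2⟩
    · refine Submodule.span_mono ?_ (T.mem_span_eig' (LinearMap.ker Y ⊓ V1)
        (fun v hv => ⟨hkerh v hv.1, hheven.2 v hv.2⟩) (fun v hv => hv.1) w1 ⟨y1, hw1⟩)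
      rintro v ⟨hv, hj⟩
      exact ⟨⟨hv.1, hj⟩, Or.inr hv.2⟩
  obtain ⟨b, hbS, hbspan, hbli⟩ := exists_linearIndependent k S
  have hbfin : b.Finite := hbli.setFinite
  have : Fintype b := hbfin.fintype
  let em := Fintype.equivFin b
  let m := Fintype.card b
  let e : Fin m → V := fun i => (em.symm i : V)
  have he : LinearIndependent k e := hbli.comp _ em.symm.injective
  have heS : ∀ i, e i ∈ S := fun i => hbS (em.symm i).2
  have hespan : Submodule.span k (Set.range e) = Submodule.span k S := by
    rw [← hbspan]
    congr 1
    ext v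
    constructor
    · rintro ⟨i, rfl⟩; exact (em.symm i).2
    · intro hv; exact ⟨em ⟨v, hv⟩, by simp [e]⟩
  have hY : ∀ i, Y (e i) = 0 := fun i => (heS i).1.1
  have hstr : ∀ i, ∃ s : ℕ, h (e i) = (2 * s : k) • e i ∧ (x ^ (2 * s + 1)) (e i) = 0 := by
    intro i
    obtain ⟨j, hj⟩ := (heS i).1.2
    obtain ⟨s, hs, hs'⟩ := T.hw_string (e i) (hY i) (he.ne_zero i) _ hj
    exact ⟨s, by rw [hj, hs], hs'⟩
  choose s hs hs' using hstr
  have hli := T.indep e he hY s hs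
  let U : Fin m → Submodule k V := fun i =>
    Submodule.span k (Set.range fun j : Fin (2 * s i + 1) => (x ^ (j : ℕ)) (e i))
  have hstring : ∀ i : Fin m, (U i = (U i ⊓ V0) ⊔ (U i ⊓ V1)) ∧
      ∃ (hx : ∀ v ∈ U i, x v ∈ U i) (n ε : ℕ), ε ≤ 1 ∧ Even n ∧
        PairIso k (V0.comap (U i).subtype) (V1.comap (U i).subtype) (x.restrict hx)
          (stringPart k n ε 0) (stringPart k n ε 1) (shiftMap k n) := by
    intro i
    have hli' : LinearIndependent k (fun j : Fin (2 * s i + 1) => (x ^ (j : ℕ)) (e i)) :=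
      hli.comp (fun j => (⟨i, j⟩ : Σ i, Fin (2 * s i + 1)))
        (fun a a' haa => eq_of_heq (Sigma.mk.inj haa).2)
    rcases (heS i).2 with h0 | h1
    · exact string_pair hcompl hodd (e i) 0 (fun _ => h0) (fun h => absurd h (by simp)) (by simp)
        (2 * s i) (hs' i) hli' (U i) rfl (even_two_mul _)
    · exact string_pair hcompl hodd (e i) 1 (fun h => absurd h (by simp)) (fun _ => h1) (by simp)
        (2 * s i) (hs' i) hli' (U i) rfl (even_two_mul _)
  refine ⟨m, U, ?_, hstring⟩
  apply DirectSum.isInternal_submodule_of_iSupIndep_of_iSup_eq_top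
  · rw [iSupIndep_def]
    intro i
    refine (hli.disjoint_span_image (s := {p | p.1 = i}) (t := {p | p.1 ≠ i}) ?_).mono ?_ ?_
    · rw [Set.disjoint_left]; intro p hp hp'; exact hp' hp
    · refine Submodule.span_mono ?_
      rintro _ ⟨j, rfl⟩
      exact ⟨⟨i, j⟩, rfl, rfl⟩
    · refine iSup₂_le fun i' hi' => Submodule.span_mono ?_
      rintro _ ⟨j, rfl⟩
      exact ⟨⟨i', j⟩, hi', rfl⟩
  · have hinv : ∀ v ∈ ⨆ i, U i, x v ∈ ⨆ i, U i := by
      have : (⨆ i, U i) ≤ (⨆ i, U i).comap x := by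
        refine iSup_le fun i v hv => ?_
        obtain ⟨hx, -⟩ := (hstring i).2
        exact Submodule.mem_iSup_of_mem i (hx v hv)
      exact this
    have hinvp : ∀ n : ℕ, ∀ v ∈ ⨆ i, U i, (x ^ n) v ∈ ⨆ i, U i := by
      intro n
      induction n with
      | zero => intro v hv; simpa using hv
      | succ n ih =>
        intro v hv
        rw [pow_succ', Module.End.mul_apply]
        exact hinv _ (ih v hv)
    have hker : LinearMap.ker Y ≤ ⨆ i, U i := by
      refine hS.trans ?_
      rw [← hespan, Submodule.span_le]
      rintro _ ⟨i, rfl⟩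
      exact Submodule.mem_iSup_of_mem i (Submodule.subset_span ⟨0, by simp⟩)
    have hall : ∀ n : ℕ, ∀ v : V, ∃ u, v - (x ^ n) u ∈ ⨆ i, U i := by
      intro n
      induction n with
      | zero => intro v; exact ⟨v, by simp⟩
      | succ n ih =>
        intro v
        obtain ⟨u, hu⟩ := ih v
        obtain ⟨a, ha, _, ⟨u', rfl⟩, hau⟩ :=
          Submodule.mem_sup.1 (T.sup_top ▸ Submodule.mem_top : u ∈ LinearMap.ker Y ⊔ LinearMap.range x)
        refine ⟨u', ?_⟩
        have : v - (x ^ (n + 1)) u' = (v - (x ^ n) u) + (x ^ n) a := by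
          rw [← hau, pow_succ, Module.End.mul_apply, map_add]; abel
        rw [this]
        exact Submodule.add_mem _ hu (hinvp n a (hker ha))
    obtain ⟨N, hN⟩ := T.nilp
    rw [eq_top_iff]
    intro v _
    obtain ⟨u, hu⟩ := hall N v
    simpa [hN] using hu
end

section
/- Let k be a field of characteristic zero, and let (V, x_V) and (W, x_W) be pairs of vector superspaces over k with odd nilpotent endomorphisms, both of which are neat. Then the tensor product pair (V ⊗ W, x_{V⊗W}) is neat (in particular x_{V⊗W} is nilpotent). [The neat subcategory of Rep(𝔾_a^{(1|1)}) is closed under tensor products.] -/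
open scoped TensorProduct

section Defs

variable (k : Type*) [Field k]

variable {V W : Type*} [AddCommGroup V] [Module k V] [AddCommGroup W] [Module k W]

/-- The set of pure tensors `v ⊗ w` with `v ∈ A`, `w ∈ B`. -/
def pureTensors (A : Submodule k V) (B : Submodule k W) : Set (V ⊗[k] W) :=
  {t | ∃ v ∈ A, ∃ w ∈ B, t = v ⊗ₜ[k] w}

/-- The even part `(V₀⊗W₀) ⊕ (V₁⊗W₁)` of the tensor product of two superspaces. -/
def tensorEven (V0 V1 : Submodule k V) (W0 W1 : Submodule k W) : Submodule k (V ⊗[k] W) :=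
  Submodule.span k (pureTensors k V0 W0 ∪ pureTensors k V1 W1)

/-- The odd part `(V₀⊗W₁) ⊕ (V₁⊗W₀)` of the tensor product of two superspaces. -/
def tensorOdd (V0 V1 : Submodule k V) (W0 W1 : Submodule k W) : Submodule k (V ⊗[k] W) :=
  Submodule.span k (pureTensors k V0 W1 ∪ pureTensors k V1 W0)

/-- `z` is the super tensor-product endomorphism induced by `x` and `y`:
`z (v ⊗ w) = x v ⊗ w + (-1)^p v ⊗ y w` for `v` homogeneous of parity `p`. -/
def IsSuperTensorMap (V0 V1 : Submodule k V) (x : V →ₗ[k] V) (y : W →ₗ[k] W)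
    (z : V ⊗[k] W →ₗ[k] V ⊗[k] W) : Prop :=
  (∀ v ∈ V0, ∀ w : W, z (v ⊗ₜ[k] w) = (x v) ⊗ₜ[k] w + v ⊗ₜ[k] (y w)) ∧
  (∀ v ∈ V1, ∀ w : W, z (v ⊗ₜ[k] w) = (x v) ⊗ₜ[k] w - v ⊗ₜ[k] (y w))

/-- Componentwise shift endomorphism on a finite direct sum of string modules. -/
def multiShift {N : ℕ} (n : Fin N → ℕ) :
    ((i : Fin N) → (Fin (n i + 1) → k)) →ₗ[k] ((i : Fin N) → (Fin (n i + 1) → k)) :=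
  LinearMap.pi (fun i => (shiftMap k (n i)).comp (LinearMap.proj i))

/-- Even/odd part of a finite direct sum of string modules `⊕ᵢ Π^{ε i} M_{n i}`. -/
def multiPart {N : ℕ} (n ε : Fin N → ℕ) (r : ℕ) :
    Submodule k ((i : Fin N) → (Fin (n i + 1) → k)) :=
  Submodule.pi Set.univ (fun i => stringPart k (n i) (ε i) r)

end Defs

namespace NeatAux

/-- An `osp(1|2)`-type structure: parity operator `P`, raising operator `x`, lowering operator `g`. -/
structure Osp {k : Type*} [Field k] {V : Type*} [AddCommGroup V] [Module k V]
    (P x g : V →ₗ[k] V) : Prop where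
  PP : ∀ v, P (P v) = v
  Px : ∀ v, P (x v) = - x (P v)
  Pg : ∀ v, P (g v) = - g (P v)
  xnil : IsNilpotent x
  gnil : IsNilpotent g
  Hx : ∀ v, x (g (x v)) + g (x (x v)) - x (x (g v) + g (x v)) = x v
  Hg : ∀ v, x (g (g v)) + g (x (g v)) - g (x (g v) + g (x v)) = - g v
  Hspan : Submodule.span k {v | ∃ μ : k, x (g v) + g (x v) = μ • v} = ⊤

section core
variable {k : Type*} [Field k] {V : Type*} [AddCommGroup V] [Module k V] {P x g : V →ₗ[k] V}

theorem Osp.swap (h : Osp P x g) : Osp P g (-x) where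
  PP := h.PP
  Px := h.Pg
  Pg v := by simp [h.Px]
  xnil := h.gnil
  gnil := h.xnil.neg
  Hx v := by
    have := h.Hg v
    simp only [LinearMap.neg_apply, map_neg, map_add] at *
    refine Eq.trans ?_ (neg_eq_iff_eq_neg.mpr this); abel
  Hg v := by
    have := h.Hx v
    simp only [LinearMap.neg_apply, map_neg, map_add] at *
    refine Eq.trans ?_ (this.trans (neg_neg _).symm); abel
  Hspan := by
    rw [eq_top_iff, ← h.Hspan, Submodule.span_le]
    rintro v ⟨μ, hv⟩
    refine Submodule.subset_span ⟨-μ, ?_⟩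
    simp only [LinearMap.neg_apply, map_neg, neg_smul, ← hv]
    abel

/-- the coefficients -/
def cf (μ : k) (j : ℕ) : k := if j % 2 = 0 then ((j / 2 : ℕ) : k) else μ + ((j / 2 : ℕ) : k)

theorem cf_succ (μ : k) (j : ℕ) : cf μ (j + 1) + cf μ j = μ + j := by
  unfold cf
  rcases Nat.even_or_odd' j with ⟨q, rfl | rfl⟩
  · have h1 : (2 * q + 1) % 2 = 1 := by omega
    have h2 : (2 * q + 1) / 2 = q := by omega
    simp [h1, h2]; ring
  · have h1 : (2 * q + 1) % 2 = 1 := by omega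
    have h2 : (2 * q + 1) / 2 = q := by omega
    have h3 : (2 * q + 1 + 1) % 2 = 0 := by omega
    have h4 : (2 * q + 1 + 1) / 2 = q + 1 := by omega
    simp [h1, h2, h3, h4]; ring

theorem Osp.wt (h : Osp P x g) {w : V} {μ : k} (hw : x (g w) + g (x w) = μ • w) (j : ℕ) :
    x (g ((x ^ j) w)) + g (x ((x ^ j) w)) = (μ + j) • (x ^ j) w := by
  induction j with
  | zero => simpa using hw
  | succ j ih =>
    rw [pow_succ', Module.End.mul_apply]
    have := h.Hx ((x ^ j) w)
    rw [ih] at this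
    rw [sub_eq_iff_eq_add] at this
    rw [this]
    simp only [map_smul]
    push_cast
    module

theorem Osp.coef (h : Osp P x g) {w : V} {μ : k} (hw : x (g w) + g (x w) = μ • w)
    (h0 : x (g w) = 0) (j : ℕ) : g ((x ^ (j + 1)) w) = cf μ (j + 1) • (x ^ j) w := by
  induction j with
  | zero => simpa [cf, h0] using hw
  | succ j ih =>
    have h1 := h.wt hw (j + 1)
    rw [ih, map_smul] at h1
    rw [pow_succ' x (j + 1), Module.End.mul_apply]
    have h2 := cf_succ μ (j + 1)
    rw [← h2, add_smul, add_comm] at h1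
    rw [pow_succ' x j, Module.End.mul_apply] at *
    exact add_right_cancel h1

variable [CharZero k]

theorem cf_eq_zero {μ : k} {j : ℕ} (hj : cf μ (j + 1) = 0) : ∃ s : ℕ, j = 2 * s ∧ μ = -(s : k) := by
  unfold cf at hj
  split_ifs at hj with h
  · exfalso
    have : (j + 1) / 2 = 0 := by exact_mod_cast hj
    omega
  · refine ⟨(j + 1) / 2, by omega, by linear_combination hj⟩

theorem cf_ne_zero (s j : ℕ) (hj : j + 1 ≤ 2 * s) : cf (-(s : k)) (j + 1) ≠ 0 := by
  intro h
  obtain ⟨t, h1, h2⟩ := cf_eq_zero h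
  have : s = t := by exact_mod_cast neg_injective h2
  omega

theorem Osp.string (h : Osp P x g) {w : V} {μ : k} (hw : x (g w) + g (x w) = μ • w)
    (h0 : x (g w) = 0) (hne : w ≠ 0) :
    ∃ s : ℕ, μ = -(s : k) ∧ (x ^ (2 * s + 1)) w = 0 := by
  classical
  obtain ⟨N, hN⟩ := h.xnil
  have hex : ∃ n, (x ^ n) w = 0 := ⟨N, by simp [hN]⟩
  obtain ⟨n, hn⟩ : ∃ n, Nat.find hex = n + 1 := by
    refine Nat.exists_eq_succ_of_ne_zero ?_
    intro h
    have := Nat.find_spec hex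
    rw [h] at this
    exact hne (by simpa using this)
  have h1 := Nat.find_spec hex
  have h2 := Nat.find_min hex (m := n) (by omega)
  rw [hn] at h1
  have h3 := h.coef hw h0 n
  rw [h1, map_zero] at h3
  have h4 : cf μ (n + 1) = 0 := (smul_eq_zero.mp h3.symm).resolve_right h2
  obtain ⟨s, rfl, hs⟩ := cf_eq_zero h4
  exact ⟨s, hs, h1⟩

/-- weight components commute with things -/
theorem Osp.ker_le_aux (h : Osp P x g) {w : V} {μ : k} (hw : x (g w) + g (x w) = μ • w)
    (h0 : x (g w) = 0) : g w = 0 := by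
  by_contra hne
  have hw0 : w ≠ 0 := by rintro rfl; simp at hne
  obtain ⟨s, hs, -⟩ := h.string hw h0 hw0
  have hH := h.Hg w
  rw [hw] at hH
  obtain ⟨t, ht, -⟩ := h.swap.string (w := g w) (μ := -(μ - 1)) (by
    simp only [LinearMap.neg_apply, map_neg, map_smul] at *
    rw [sub_eq_iff_eq_add] at hH
    rw [← neg_add, add_comm (g _), hH]
    module) (by simp [h0]) hne
  rw [hs] at ht
  have : ((s + 1 + t : ℕ) : k) = 0 := by push_cast; linear_combination ht
  have : s + 1 + t = 0 := by exact_mod_cast this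
  omega

variable [FiniteDimensional k V]

theorem Osp.iSup_eig (h : Osp P x g) :
    ⨆ μ, Module.End.genEigenspace (x * g + g * x : Module.End k V) μ 1 = ⊤ := by
  rw [eq_top_iff, ← h.Hspan, Submodule.span_le]
  rintro v ⟨μ, hv⟩
  refine Submodule.mem_iSup_of_mem μ ?_
  exact Module.End.mem_eigenspace_iff.mpr hv

theorem Osp.ker_spec (h : Osp P x g) (S : Submodule k V)
    (hS : ∀ v ∈ S, x (g v) + g (x v) ∈ S) (T : Submodule k V)
    (hT : ∀ v ∈ S, ∀ μ : k, x (g v) + g (x v) = μ • v → v ∈ T) : S ≤ T := by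
  rw [Submodule.eq_iSup_inf_genEigenspace (f := (x * g + g * x : Module.End k V)) 1 hS h.iSup_eig]
  refine iSup_le fun μ => ?_
  rintro v ⟨h1, h2⟩
  exact hT v h1 μ (Module.End.mem_eigenspace_iff.mp h2)

theorem Osp.ker_le (h : Osp P x g) : LinearMap.ker (x ∘ₗ g) ≤ LinearMap.ker g := by
  refine h.ker_spec _ ?_ _ ?_
  · intro v hv
    simp only [LinearMap.mem_ker, LinearMap.comp_apply] at *
    have h1 := h.Hg v
    have h2 := h.Hx (g v)
    simp only [hv, map_zero, add_zero, zero_sub, neg_eq_zero] at h2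
    rw [hv, map_zero, add_zero, zero_add] at h1
    have h3 := congrArg x h1
    rw [map_sub, h2, map_neg, hv] at h3
    rw [hv, zero_add]
    simpa using h3
  · intro v hv μ hμ
    exact h.ker_le_aux hμ hv

theorem Osp.disj (h : Osp P x g) : Disjoint (LinearMap.range g) (LinearMap.ker x) := by
  rw [Submodule.disjoint_def]
  rintro _ ⟨w, rfl⟩ hw
  exact h.ker_le hw

theorem Osp.codisj (h : Osp P x g) : LinearMap.range x ⊔ LinearMap.ker g = ⊤ := by
  have h1 := h.disj
  have h2 := h.swap.disj
  have h3 : LinearMap.range (-x) = LinearMap.range x := LinearMap.range_neg x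
  rw [h3] at h2
  apply Submodule.eq_top_of_finrank_eq
  have e1 := Submodule.finrank_sup_add_finrank_inf_eq (LinearMap.range g) (LinearMap.ker x)
  have e2 := Submodule.finrank_sup_add_finrank_inf_eq (LinearMap.range x) (LinearMap.ker g)
  rw [h1.eq_bot, finrank_bot] at e1
  rw [h2.eq_bot, finrank_bot] at e2
  have e3 := LinearMap.finrank_range_add_finrank_ker x
  have e4 := LinearMap.finrank_range_add_finrank_ker g
  have e5 := Submodule.finrank_le (LinearMap.range g ⊔ LinearMap.ker x)
  have e6 := Submodule.finrank_le (LinearMap.range x ⊔ LinearMap.ker g)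
  omega

end core
end NeatAux

namespace NeatAux
section basis
variable {k : Type*} [Field k] {V : Type*} [AddCommGroup V] [Module k V] 

/-- A basis of homogeneous strings of odd length. -/
structure StrBasis (P x : V →ₗ[k] V) {m : ℕ} (s ε : Fin m → ℕ)
    (b : Module.Basis (Σ i : Fin m, Fin (2 * s i + 1)) k V) : Prop where
  hε : ∀ i, ε i ≤ 1
  hP : ∀ i j, P (b ⟨i, j⟩) = (-1 : k) ^ ((j : ℕ) + ε i) • b ⟨i, j⟩
  hx : ∀ i (j : Fin (2 * s i)), x (b ⟨i, j.castSucc⟩) = b ⟨i, j.succ⟩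
  hx0 : ∀ i, x (b ⟨i, Fin.last _⟩) = 0

/-- the string map -/
noncomputable def strMap {m : ℕ} (s : Fin m → ℕ)
    (b : Module.Basis (Σ i : Fin m, Fin (2 * s i + 1)) k V) (i : Fin m) :
    (Fin (2 * s i + 1) → k) →ₗ[k] V :=
  Fintype.linearCombination k (fun j => b ⟨i, j⟩)

variable {P x : V →ₗ[k] V} {m : ℕ} {s ε : Fin m → ℕ}
    {b : Module.Basis (Σ i : Fin m, Fin (2 * s i + 1)) k V}

theorem strMap_apply (i : Fin m) (f) : strMap s b i f = ∑ j, f j • b ⟨i, j⟩ := rfl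

theorem strMap_inj (i : Fin m) : Function.Injective (strMap s b i) := by
  have : LinearIndependent k (fun j => b ⟨i, j⟩) :=
    b.linearIndependent.comp _ sigma_mk_injective
  exact this.fintypeLinearCombination_injective

theorem shiftMap_zero (n : ℕ) (f : Fin (n + 1) → k) : shiftMap k n f 0 = 0 := by
  simp [shiftMap]

theorem shiftMap_succ (n : ℕ) (f : Fin (n + 1) → k) (j : Fin n) :
    shiftMap k n f j.succ = f j.castSucc := by
  simp [shiftMap]
  rfl

theorem StrBasis.shift (h : StrBasis P x s ε b) (i : Fin m) (f) :
    x (strMap s b i f) = strMap s b i (shiftMap k _ f) := by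
  rw [strMap_apply, strMap_apply, map_sum, Fin.sum_univ_castSucc,
    Fin.sum_univ_succ (f := fun j => (shiftMap k (2 * s i)) f j • b ⟨i, j⟩)]
  simp only [map_smul, h.hx, h.hx0, smul_zero, add_zero, shiftMap_zero, shiftMap_succ, zero_smul,
    zero_add]

theorem StrBasis.par (h : StrBasis P x s ε b) (i : Fin m) (f) :
    P (strMap s b i f) = strMap s b i (fun j => (-1 : k) ^ ((j : ℕ) + ε i) * f j) := by
  rw [strMap_apply, strMap_apply, map_sum]
  refine Finset.sum_congr rfl fun j _ => ?_
  rw [map_smul, h.hP, smul_smul, mul_comm]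

theorem range_strMap (i : Fin m) : LinearMap.range (strMap s b i) =
    Submodule.span k (b '' (Sigma.fst ⁻¹' {i})) := by
  rw [strMap, Fintype.range_linearCombination]
  congr 1
  ext v
  constructor
  · rintro ⟨j, rfl⟩; exact ⟨⟨i, j⟩, rfl, rfl⟩
  · rintro ⟨⟨i', j⟩, h, rfl⟩
    obtain rfl : i' = i := h
    exact ⟨j, rfl⟩

theorem isInternal_strMap : DirectSum.IsInternal (fun i => LinearMap.range (strMap s b i)) := by
  apply DirectSum.isInternal_submodule_of_iSupIndep_of_iSup_eq_top
  · rw [iSupIndep_def]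
    intro i
    simp only [range_strMap]
    rw [← Submodule.span_iUnion₂, ← Set.image_iUnion₂]
    apply b.linearIndependent.disjoint_span_image
    rw [Set.disjoint_left]
    rintro p hp hp'
    simp at hp hp'
    exact hp' hp
  · rw [eq_top_iff, ← b.span_eq, Submodule.span_le]
    rintro _ ⟨⟨i, j⟩, rfl⟩
    refine Submodule.mem_iSup_of_mem i ?_
    rw [range_strMap]
    exact Submodule.subset_span ⟨⟨i, j⟩, rfl, rfl⟩

variable [CharZero k]

theorem mem_stringPart {n e r : ℕ} {f : Fin (n + 1) → k} :
    f ∈ stringPart k n e r ↔ ∀ j : Fin (n + 1), (j + e) % 2 ≠ r → f j = 0 := by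
  simp only [stringPart, Submodule.mem_pi, Set.mem_univ, forall_true_left]
  refine forall_congr' fun j => ?_
  split_ifs with h <;> simp [h]

theorem StrBasis.isNeat (h : StrBasis P x s ε b) {V0 V1 : Submodule k V}
    (hPP : ∀ v, P (P v) = v)
    (h0 : ∀ v, v ∈ V0 ↔ P v = v) (h1 : ∀ v, v ∈ V1 ↔ P v = -v) : IsNeat k V0 V1 x := by
  refine ⟨m, fun i => LinearMap.range (strMap s b i), isInternal_strMap, fun i => ⟨?_, ?_, ?_⟩⟩
  · apply le_antisymm
    · rintro v hv
      have hPv : P v ∈ LinearMap.range (strMap s b i) := by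
        obtain ⟨f, rfl⟩ := hv
        rw [h.par]
        exact ⟨_, rfl⟩
      rw [Submodule.mem_sup]
      refine ⟨(2⁻¹ : k) • (v + P v), ⟨Submodule.smul_mem _ _ (Submodule.add_mem _ hv hPv), ?_⟩,
        (2⁻¹ : k) • (v - P v), ⟨Submodule.smul_mem _ _ (Submodule.sub_mem _ hv hPv), ?_⟩, ?_⟩
      · rw [SetLike.mem_coe, h0]; simp [hPP, add_comm]
      · rw [SetLike.mem_coe, h1]; simp [hPP, ← smul_neg]
      · rw [← smul_add, add_add_sub_cancel, ← two_smul k v, smul_smul]; simp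
    · exact sup_le inf_le_left inf_le_left
  · rintro _ ⟨f, rfl⟩
    rw [h.shift]
    exact ⟨_, rfl⟩
  · refine ⟨2 * s i, ε i, h.hε i, even_two_mul _, ?_⟩
    have key : ∀ f : Fin (2 * s i + 1) → k,
      (LinearEquiv.ofInjective (strMap s b i) (strMap_inj i)).symm ⟨strMap s b i f, ⟨f, rfl⟩⟩ = f :=
      fun f => by
        rw [LinearEquiv.symm_apply_eq]; rfl
    refine ⟨(LinearEquiv.ofInjective (strMap s b i) (strMap_inj i)).symm, ?_, ?_, ?_⟩
    · rintro ⟨_, ⟨f, rfl⟩⟩ hv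
      rw [key, mem_stringPart]
      intro j hj
      have hv' : strMap s b i f ∈ V0 := hv
      rw [h0, h.par] at hv'
      have := congrFun (strMap_inj i hv') j
      have ho : Odd ((j : ℕ) + ε i) := by rw [Nat.odd_iff]; omega
      simp only [ho.neg_one_pow] at this
      exact self_eq_neg.mp (by simpa using this.symm)
    · rintro ⟨_, ⟨f, rfl⟩⟩ hv
      rw [key, mem_stringPart]
      intro j hj
      have hv' : strMap s b i f ∈ V1 := hv
      rw [h1, h.par, ← map_neg] at hv'
      have := congrFun (strMap_inj i hv') j
      have ho : Even ((j : ℕ) + ε i) := by rw [Nat.even_iff]; omega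
      simp only [ho.neg_one_pow] at this
      exact self_eq_neg.mp (by simpa using this)
    · rintro ⟨_, ⟨f, rfl⟩⟩
      rw [key]
      rw [LinearEquiv.symm_apply_eq]
      apply Subtype.ext
      exact h.shift i f

theorem exists_strBasis {V0 V1 : Submodule k V} 
    (h0 : ∀ v, v ∈ V0 ↔ P v = v) (h1 : ∀ v, v ∈ V1 ↔ P v = -v) (h : IsNeat k V0 V1 x) :
    ∃ (m : ℕ) (s ε : Fin m → ℕ) (b : Module.Basis (Σ i : Fin m, Fin (2 * s i + 1)) k V),
      StrBasis P x s ε b := by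
  obtain ⟨m, U, hU, hi⟩ := h
  choose hgr hxU n ε hε hn φ hφ0 hφ1 hφx using hi
  have hn' : ∀ i, ∃ s, n i = 2 * s := fun i => (hn i).exists_two_nsmul _ |>.imp (by simp)
  choose s hs using hn'
  obtain rfl : n = fun i => 2 * s i := funext hs
  let b := hU.collectedBasis (fun i => Module.Basis.ofEquivFun (φ i))
  have hb : ∀ i j, b ⟨i, j⟩ = ((φ i).symm (Pi.single j 1) : V) := by
    intro i j
    simp [b]
  refine ⟨m, s, ε, b, hε, ?_, ?_, ?_⟩
  · intro i j
    rw [hb]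
    set v := (φ i).symm (Pi.single j 1) with hv
    have hφv : φ i v = Pi.single j 1 := by simp [hv]
    have hvU := v.2
    replace hvU := (hgr i).le hvU
    rw [Submodule.mem_sup] at hvU
    obtain ⟨a0, ⟨ha0, ha0'⟩, a1, ⟨ha1, ha1'⟩, hsum⟩ := hvU
    have e0 := mem_stringPart.mp (hφ0 i ⟨a0, ha0⟩ ha0')
    have e1 := mem_stringPart.mp (hφ1 i ⟨a1, ha1⟩ ha1')
    have hs' : φ i ⟨a0, ha0⟩ + φ i ⟨a1, ha1⟩ = Pi.single j 1 := by
      rw [← map_add, ← hφv]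
      congr 1
      exact Subtype.ext hsum
    rcases Nat.even_or_odd ((j : ℕ) + ε i) with he | ho
    · have hz : φ i ⟨a1, ha1⟩ = 0 := by
        ext l
        by_cases hl : ((l : ℕ) + ε i) % 2 = 1
        · have hlj : l ≠ j := by rintro rfl; rw [Nat.even_iff] at he; omega
          have := congrFun hs' l
          rw [Pi.add_apply, e0 l (by omega), Pi.single_eq_of_ne hlj] at this
          simpa using this
        · exact e1 l hl
      have : a1 = 0 := by
        have := (φ i).map_eq_zero_iff.mp hz
        exact congrArg Subtype.val this
      rw [← hsum, this, add_zero, he.neg_one_pow, one_smul]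
      exact (h0 a0).mp ha0'
    · have hz : φ i ⟨a0, ha0⟩ = 0 := by
        ext l
        by_cases hl : ((l : ℕ) + ε i) % 2 = 0
        · have hlj : l ≠ j := by rintro rfl; rw [Nat.odd_iff] at ho; omega
          have := congrFun hs' l
          rw [Pi.add_apply, e1 l (by omega), Pi.single_eq_of_ne hlj] at this
          simpa using this
        · exact e0 l hl
      have : a0 = 0 := by
        have := (φ i).map_eq_zero_iff.mp hz
        exact congrArg Subtype.val this
      rw [← hsum, this, zero_add, ho.neg_one_pow, neg_one_smul]
      exact (h1 a1).mp ha1'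
  · intro i j
    rw [hb, hb]
    have := hφx i ((φ i).symm (Pi.single j.castSucc 1))
    rw [LinearEquiv.apply_symm_apply, ← LinearEquiv.eq_symm_apply] at this
    have h2 := congrArg Subtype.val this
    rw [LinearMap.coe_restrict_apply] at h2
    rw [h2]
    congr 2
    ext l
    refine Fin.cases ?_ (fun l => ?_) l
    · rw [shiftMap_zero, Pi.single_eq_of_ne (Fin.succ_ne_zero j).symm]
    · rw [shiftMap_succ]; simp [Pi.single_apply]
  · intro i
    rw [hb]
    have := hφx i ((φ i).symm (Pi.single (Fin.last _) 1))
    rw [LinearEquiv.apply_symm_apply, ← LinearEquiv.eq_symm_apply] at this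
    have h2 := congrArg Subtype.val this
    rw [LinearMap.coe_restrict_apply] at h2
    rw [h2]
    have : shiftMap k (2 * s i) (Pi.single (Fin.last _) 1) = 0 := by
      ext l
      refine Fin.cases ?_ (fun l => ?_) l
      · rw [shiftMap_zero]; rfl
      · rw [shiftMap_succ, Pi.single_eq_of_ne (Fin.castSucc_lt_last l).ne]; rfl
    simp [this]

end basis
end NeatAux

namespace NeatAux
section conv
variable {k : Type*} [Field k] {V : Type*} [AddCommGroup V] [Module k V]
variable {P x : V →ₗ[k] V} {m : ℕ} {s ε : Fin m → ℕ}
    {b : Module.Basis (Σ i : Fin m, Fin (2 * s i + 1)) k V}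

theorem StrBasis.exists_osp (h : StrBasis P x s ε b) (xnil : IsNilpotent x) :
    ∃ g, Osp P x g := by
  classical
  let B : Fin m → ℕ → V := fun i j => if hj : j < 2 * s i + 1 then b ⟨i, ⟨j, hj⟩⟩ else 0
  have hbB : ∀ p, b p = B p.1 p.2 := by
    rintro ⟨i, j⟩
    simp only [B]
    rw [dif_pos j.2]
  have hB0 : ∀ i j, 2 * s i < j → B i j = 0 := by
    intro i j hj
    simp only [B]
    rw [dif_neg (by omega)]
  have hxB : ∀ i j, x (B i j) = B i (j + 1) := by
    intro i j
    rcases lt_trichotomy j (2 * s i) with hj | rfl | hj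
    · have := h.hx i ⟨j, hj⟩
      rw [hbB, hbB] at this
      simpa using this
    · have := h.hx0 i
      rw [hbB] at this
      rw [hB0 i (2 * s i + 1) (by omega)]
      simpa using this
    · rw [hB0 i j hj, hB0 i _ (by omega), map_zero]
  have hPB : ∀ i j, P (B i j) = (-1 : k) ^ (j + ε i) • B i j := by
    intro i j
    by_cases hj : j < 2 * s i + 1
    · have := h.hP i ⟨j, hj⟩
      rw [hbB] at this
      exact this
    · rw [hB0 i j (by omega)]; simp
  let g : V →ₗ[k] V := b.constr k (fun p => cf (-(s p.1 : k)) p.2 • B p.1 (p.2 - 1))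
  have hg0 : ∀ i, g (B i 0) = 0 := by
    intro i
    have := hbB ⟨i, 0⟩
    simp only [Fin.val_zero] at this
    rw [← this]
    simp only [g, Module.Basis.constr_basis]
    simp [cf]
  have hgB : ∀ i j, g (B i (j + 1)) = cf (-(s i : k)) (j + 1) • B i j := by
    intro i j
    rcases lt_trichotomy j (2 * s i) with hj | rfl | hj
    · have := hbB ⟨i, ⟨j + 1, by omega⟩⟩
      simp only at this
      rw [← this]
      simp [g]
    · rw [hB0 i _ (by omega), map_zero]
      have h1 : (2 * s i + 1) % 2 ≠ 0 := by omega
      have h2 : (2 * s i + 1) / 2 = s i := by omega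
      simp [cf, h2]
    · rw [hB0 i j hj, hB0 i _ (by omega), map_zero, smul_zero]
  have hH : ∀ i j, x (g (B i j)) + g (x (B i j)) = (-(s i : k) + j) • B i j := by
    intro i j
    rw [← cf_succ, add_smul, hxB, hgB, add_comm]
    congr 1
    cases j with
    | zero => simp [hg0, cf]
    | succ j => rw [hgB, map_smul, hxB]
  have ext : ∀ {f f' : V →ₗ[k] V}, (∀ i j, f (B i j) = f' (B i j)) → ∀ v, f v = f' v := by
    intro f f' hf v
    have : f = f' := b.ext fun p => by rw [hbB]; exact hf _ _
    rw [this]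
  have hgN : ∀ N i j, j < N → (g ^ N) (B i j) = 0 := by
    intro N
    induction N with
    | zero => intro i j hj; omega
    | succ N ih =>
      intro i j hj
      rw [pow_succ, Module.End.mul_apply]
      cases j with
      | zero => rw [hg0, map_zero]
      | succ j => rw [hgB, map_smul, ih i j (by omega), smul_zero]
  have hPP : ∀ i j, P (P (B i j)) = B i j := by
    intro i j
    rw [hPB, map_smul, hPB, smul_smul, ← mul_pow]; simp
  refine ⟨g, ?_, ?_, ?_, xnil, ?_, ?_, ?_, ?_⟩
  · exact ext (f := P ∘ₗ P) (f' := LinearMap.id) hPP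
  · refine ext (f := P ∘ₗ x) (f' := -(x ∘ₗ P)) fun i j => ?_
    simp only [LinearMap.comp_apply, LinearMap.neg_apply, hxB, hPB, map_smul]
    rw [show j + 1 + ε i = (j + ε i) + 1 by ring, pow_succ]; simp
  · refine ext (f := P ∘ₗ g) (f' := -(g ∘ₗ P)) fun i j => ?_
    simp only [LinearMap.comp_apply, LinearMap.neg_apply, hPB, map_smul]
    cases j with
    | zero => simp [hg0]
    | succ j =>
      rw [hgB, map_smul, hPB, show j + 1 + ε i = (j + ε i) + 1 by ring, pow_succ,
        smul_comm]; simp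
  · refine ⟨2 * ∑ i, s i + 1, LinearMap.ext (ext fun i j => ?_)⟩
    rw [LinearMap.zero_apply]
    by_cases hj : 2 * s i < j
    · rw [hB0 i j hj, map_zero]
    · apply hgN
      have : s i ≤ ∑ i, s i := Finset.single_le_sum (fun _ _ => Nat.zero_le _) (Finset.mem_univ i)
      omega
  · refine ext (f := (x ∘ₗ g + g ∘ₗ x) ∘ₗ x - x ∘ₗ (x ∘ₗ g + g ∘ₗ x)) fun i j => ?_
    simp only [LinearMap.comp_apply, LinearMap.add_apply, LinearMap.sub_apply, hH, map_smul]
    rw [hxB, hH]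
    push_cast
    module
  · refine ext (f := (x ∘ₗ g + g ∘ₗ x) ∘ₗ g - g ∘ₗ (x ∘ₗ g + g ∘ₗ x)) (f' := -g) fun i j => ?_
    simp only [LinearMap.comp_apply, LinearMap.add_apply, LinearMap.sub_apply, hH, map_smul,
      LinearMap.neg_apply]
    cases j with
    | zero => simp [hg0]
    | succ j =>
      rw [hgB]
      simp only [map_smul, ← smul_add, hH]
      push_cast
      module
  · rw [eq_top_iff, ← b.span_eq]
    apply Submodule.span_mono
    rintro _ ⟨p, rfl⟩
    refine ⟨-(s p.1 : k) + (p.2 : ℕ), ?_⟩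
    rw [hbB]
    exact hH _ _

variable [CharZero k] [FiniteDimensional k V]

theorem Osp.exists_strBasis {g : V →ₗ[k] V} (h : Osp P x g) :
    ∃ (m : ℕ) (s ε : Fin m → ℕ) (b : Module.Basis (Σ i : Fin m, Fin (2 * s i + 1)) k V),
      StrBasis P x s ε b := by
  classical
  let S : Set V := {v | g v = 0 ∧ (∃ e : ℕ, e ≤ 1 ∧ P v = (-1 : k) ^ e • v) ∧
    ∃ μ : k, x (g v) + g (x v) = μ • v}
  have hS : LinearMap.ker g ≤ Submodule.span k S := by
    refine h.ker_spec _ ?_ _ ?_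
    · intro v hv
      rw [LinearMap.mem_ker] at *
      have := h.Hg v
      simpa [hv] using this
    · intro v hv μ hμ
      rw [LinearMap.mem_ker] at hv
      have hgP : g (P v) = 0 := by
        have := h.Pg v
        rw [hv, map_zero] at this
        exact neg_eq_zero.mp this.symm
      have hHP : g (x (P v)) = μ • P v := by
        rw [← map_smul, ← hμ, map_add, hv, map_zero, map_zero, zero_add, h.Pg, h.Px]
        simp
      rw [hv, map_zero, zero_add] at hμ
      have e : v = (2⁻¹ : k) • (v + P v) + (2⁻¹ : k) • (v - P v) := by
        rw [← smul_add, add_add_sub_cancel, ← two_smul k v, smul_smul]; simp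
      rw [e]
      refine Submodule.add_mem _ (Submodule.smul_mem _ _ (Submodule.subset_span ?_))
        (Submodule.smul_mem _ _ (Submodule.subset_span ?_))
      · refine ⟨by simp [hv, hgP], ⟨0, by simp, by simp [h.PP, add_comm]⟩, μ, ?_⟩
        simp [hv, hgP, hμ, hHP]
      · refine ⟨by simp [hv, hgP], ⟨1, by simp, by simp [h.PP]⟩, μ, ?_⟩
        simp [hv, hgP, hμ, hHP, smul_sub]
  obtain ⟨T, hTS, hTspan, hTli⟩ := exists_linearIndependent k S
  have hfin : Finite T := hTli.finite
  obtain ⟨m, ⟨eq⟩⟩ := Finite.exists_equiv_fin T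
  let u : Fin m → V := fun i => (eq.symm i : V)
  have hu : ∀ i, u i ∈ S := fun i => hTS (eq.symm i).2
  have huli : LinearIndependent k u := hTli.comp _ eq.symm.injective
  have huspan : Submodule.span k (Set.range u) = Submodule.span k S := by
    rw [← hTspan]
    congr 1
    ext v
    constructor
    · rintro ⟨i, rfl⟩; exact (eq.symm i).2
    · intro hv; exact ⟨eq ⟨v, hv⟩, by simp [u]⟩
  choose hgu hPu hHu using hu
  choose ε hε hPu using hPu
  choose μ hHu using hHu
  have hstr := fun i => h.string (hHu i) (by rw [hgu, map_zero]) (huli.ne_zero i)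
  choose s hs hxs using hstr
  have hcoef : ∀ i j, g ((x ^ (j + 1)) (u i)) = cf (-(s i : k)) (j + 1) • (x ^ j) (u i) := by
    intro i j
    rw [← hs i]
    exact h.coef (hHu i) (by rw [hgu, map_zero]) j
  have hx0 : ∀ i j, 2 * s i < j → (x ^ j) (u i) = 0 := by
    intro i j hj
    obtain ⟨l, rfl⟩ := Nat.exists_eq_add_of_lt hj
    rw [show 2 * s i + l + 1 = l + (2 * s i + 1) by ring, pow_add, Module.End.mul_apply, hxs,
      map_zero]
  have hind : ∀ J, ∀ a : Fin m → ℕ → k, (∀ i j, 2 * s i < j → a i j = 0) →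
      ∑ i, ∑ j ∈ Finset.range J, a i j • (x ^ j) (u i) = 0 → ∀ i, ∀ j < J, a i j = 0 := by
    intro J
    induction J with
    | zero => intro a _ _ i j hj; omega
    | succ J ih =>
      intro a ha hsum
      have h1 := congrArg g hsum
      simp only [Finset.sum_range_succ', map_sum, map_add, map_smul, hcoef, pow_zero,
        Module.End.one_apply, hgu, smul_zero, add_zero, map_zero, smul_smul] at h1
      have h2 := ih (fun i j => a i (j + 1) * cf (-(s i : k)) (j + 1))
        (fun i j hj => by rw [ha i (j + 1) (by omega), zero_mul]) h1
      have h3 : ∀ i, ∀ j < J, a i (j + 1) = 0 := by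
        intro i j hj
        by_cases hj' : 2 * s i < j + 1
        · exact ha i _ hj'
        · exact (mul_eq_zero.mp (h2 i j hj)).resolve_right (cf_ne_zero _ _ (by omega))
      have h4 : ∑ i, a i 0 • u i = 0 := by
        rw [← hsum]
        refine Finset.sum_congr rfl fun i _ => ?_
        rw [Finset.sum_range_succ', Finset.sum_eq_zero]
        · simp
        · intro j hj
          rw [h3 i j (Finset.mem_range.mp hj), zero_smul]
      have h5 := Fintype.linearIndependent_iff.mp huli _ h4
      intro i j hj
      cases j with
      | zero => exact h5 i
      | succ j => exact h3 i j (by omega)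
  let v : (Σ i : Fin m, Fin (2 * s i + 1)) → V := fun p => (x ^ (p.2 : ℕ)) (u p.1)
  have hvli : LinearIndependent k v := by
    rw [Fintype.linearIndependent_iff]
    intro c hc
    let a : Fin m → ℕ → k := fun i j => if hj : j < 2 * s i + 1 then c ⟨i, ⟨j, hj⟩⟩ else 0
    have ha : ∀ i j, 2 * s i < j → a i j = 0 := fun i j hj => by
      simp only [a]; rw [dif_neg (by omega)]
    have hle : ∀ i, 2 * s i + 1 ≤ 2 * ∑ i, s i + 1 := fun i => by
      have : s i ≤ ∑ i, s i := Finset.single_le_sum (fun _ _ => Nat.zero_le _) (Finset.mem_univ i)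
      omega
    have := hind (2 * ∑ i, s i + 1) a ha (by
      rw [← hc, Fintype.sum_sigma]
      refine Finset.sum_congr rfl fun i _ => ?_
      rw [← Finset.sum_subset (Finset.range_mono (hle i)), Finset.sum_range]
      · refine Finset.sum_congr rfl fun j _ => ?_
        simp only [a, v]
        rw [dif_pos j.2]
      · intro j _ hj
        rw [ha i j (by simpa using hj), zero_smul])
    rintro ⟨i, j⟩
    have h2 := this i j (lt_of_lt_of_le j.2 (hle i))
    simp only [a] at h2
    rwa [dif_pos j.2] at h2
  let N := Submodule.span k (Set.range v)
  have hmem : ∀ i j, (x ^ j) (u i) ∈ N := by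
    intro i j
    by_cases hj : j < 2 * s i + 1
    · exact Submodule.subset_span ⟨⟨i, ⟨j, hj⟩⟩, rfl⟩
    · rw [hx0 i j (by omega)]; exact N.zero_mem
  have hKN : ∀ r, ∀ c ∈ LinearMap.ker g, (x ^ r) c ∈ N := by
    intro r c hc
    have hc := hS hc
    rw [← huspan] at hc
    have : Submodule.span k (Set.range u) ≤ N.comap (x ^ r) := by
      rw [Submodule.span_le]
      rintro _ ⟨i, rfl⟩
      exact hmem i r
    exact this hc
  have hr : ∀ r, ⊤ ≤ N ⊔ LinearMap.range (x ^ r) := by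
    intro r
    induction r with
    | zero => simp [Module.End.one_eq_id]
    | succ r ih =>
      refine ih.trans (sup_le le_sup_left ?_)
      rintro _ ⟨w, rfl⟩
      have : w ∈ LinearMap.range x ⊔ LinearMap.ker g := by rw [h.codisj]; trivial
      obtain ⟨_, ⟨a, rfl⟩, c, hc, rfl⟩ := Submodule.mem_sup.mp this
      rw [map_add]
      refine Submodule.add_mem _ (Submodule.mem_sup_right ⟨a, ?_⟩)
        (Submodule.mem_sup_left (hKN r c hc))
      rw [pow_succ, Module.End.mul_apply]
  have hN : ⊤ ≤ N := by
    obtain ⟨r, hr0⟩ := h.xnil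
    have := hr r
    rwa [hr0, LinearMap.range_zero, sup_bot_eq] at this
  have hPx : ∀ j w, P ((x ^ j) w) = (-1 : k) ^ j • (x ^ j) (P w) := by
    intro j
    induction j with
    | zero => simp
    | succ j ih =>
      intro w
      rw [pow_succ' x, Module.End.mul_apply, h.Px, ih, Module.End.mul_apply, map_smul, pow_succ]
      simp
  refine ⟨m, s, ε, Module.Basis.mk hvli hN, hε, ?_, ?_, ?_⟩
  · intro i j
    simp only [Module.Basis.mk_apply, v]
    rw [hPx, hPu, map_smul, smul_smul, pow_add]
  · intro i j
    simp only [Module.Basis.mk_apply, v, Fin.val_castSucc, Fin.val_succ]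
    rw [pow_succ', Module.End.mul_apply]
  · intro i
    simp only [Module.Basis.mk_apply, v, Fin.val_last]
    rw [← Module.End.mul_apply, ← pow_succ', hxs]

end conv
end NeatAux

namespace NeatAux
section tens
open TensorProduct
variable {k : Type*} [Field k] {V : Type*} [AddCommGroup V] [Module k V]
  {W : Type*} [AddCommGroup W] [Module k W]
variable {P x g : V →ₗ[k] V} {Q y h : W →ₗ[k] W}

theorem nil_tensor (hPP : ∀ v, P (P v) = v) (hPx : ∀ v, P (x v) = - x (P v))
    (hx : IsNilpotent x) (hy : IsNilpotent y) :
    IsNilpotent (map x LinearMap.id + map P y : V ⊗[k] W →ₗ[k] V ⊗[k] W) := by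
  have hsq : (map x LinearMap.id + map P y : Module.End k (V ⊗[k] W)) ^ 2 =
      (LinearMap.rTensor W x) ^ 2 + (LinearMap.lTensor V y) ^ 2 := by
    apply TensorProduct.ext'
    intro v w
    simp [pow_two, Module.End.mul_apply, hPP, hPx, neg_tmul]
  have h1 : IsNilpotent (LinearMap.rTensor W x : Module.End k (V ⊗[k] W)) := by
    obtain ⟨n, hn⟩ := hx
    exact ⟨n, by rw [LinearMap.rTensor_pow, hn, LinearMap.rTensor_zero]⟩
  have h2 : IsNilpotent (LinearMap.lTensor V y : Module.End k (V ⊗[k] W)) := by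
    obtain ⟨n, hn⟩ := hy
    exact ⟨n, by rw [LinearMap.lTensor_pow, hn, LinearMap.lTensor_zero]⟩
  have hc : Commute (LinearMap.rTensor W x : Module.End k (V ⊗[k] W)) (LinearMap.lTensor V y) := by
    apply TensorProduct.ext'
    intro v w
    simp [Module.End.mul_apply]
  have h3 := (hc.pow_pow 2 2).isNilpotent_add (h1.pow_of_pos two_ne_zero)
    (h2.pow_of_pos two_ne_zero)
  rw [← hsq] at h3
  exact (IsNilpotent.pow_iff_pos two_ne_zero).mp h3

theorem Osp.tensor (a : Osp P x g) (b : Osp Q y h) :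
    Osp (map P Q : V ⊗[k] W →ₗ[k] V ⊗[k] W) (map x LinearMap.id + map P y)
      (map g LinearMap.id + map P h) := by
  have ext : ∀ {f f' : V ⊗[k] W →ₗ[k] V ⊗[k] W},
      (∀ v w, f (v ⊗ₜ w) = f' (v ⊗ₜ w)) → ∀ t, f t = f' t := by
    intro f f' hf t
    rw [TensorProduct.ext' hf]
  set Z : V ⊗[k] W →ₗ[k] V ⊗[k] W := map x LinearMap.id + map P y with hZ
  set G : V ⊗[k] W →ₗ[k] V ⊗[k] W := map g LinearMap.id + map P h with hG
  have hZa : ∀ v w, Z (v ⊗ₜ w) = x v ⊗ₜ w + P v ⊗ₜ y w := fun v w => by simp [hZ]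
  have hGa : ∀ v w, G (v ⊗ₜ w) = g v ⊗ₜ w + P v ⊗ₜ h w := fun v w => by simp [hG]
  have hH : ∀ v w, Z (G (v ⊗ₜ w)) + G (Z (v ⊗ₜ w)) =
      (x (g v) + g (x v)) ⊗ₜ w + v ⊗ₜ (y (h w) + h (y w)) := by
    intro v w
    simp only [hZa, hGa, map_add, a.Px, a.Pg, a.PP, neg_tmul, add_tmul, tmul_add]
    abel
  have hHP : ∀ v, x (g (P v)) + g (x (P v)) = P (x (g v) + g (x v)) := by
    intro v
    simp [a.Px, a.Pg]
  refine ⟨?_, ?_, ?_, nil_tensor a.PP a.Px a.xnil b.xnil, nil_tensor a.PP a.Pg a.gnil b.gnil,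
    ?_, ?_, ?_⟩
  · refine ext (f := map P Q ∘ₗ map P Q) (f' := LinearMap.id) fun v w => ?_
    simp [a.PP, b.PP]
  · refine ext (f := map P Q ∘ₗ Z) (f' := -(Z ∘ₗ map P Q)) fun v w => ?_
    simp [hZa, a.PP, a.Px, b.Px, neg_tmul, tmul_neg]
    abel
  · refine ext (f := map P Q ∘ₗ G) (f' := -(G ∘ₗ map P Q)) fun v w => ?_
    simp [hGa, a.PP, a.Pg, b.Pg, neg_tmul, tmul_neg]
    abel
  · refine ext (f := (Z ∘ₗ G + G ∘ₗ Z) ∘ₗ Z - Z ∘ₗ (Z ∘ₗ G + G ∘ₗ Z)) fun v w => ?_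
    simp only [LinearMap.comp_apply, LinearMap.add_apply, LinearMap.sub_apply, hH]
    have e1 := sub_eq_iff_eq_add.mp (a.Hx v)
    have e2 := sub_eq_iff_eq_add.mp (b.Hx w)
    have e3 : ∀ v w, (Z (G (v ⊗ₜ w)) + G (Z (v ⊗ₜ w))) = (Z ∘ₗ G + G ∘ₗ Z) (v ⊗ₜ w) :=
      fun _ _ => rfl
    rw [hZa]
    have e4 : ∀ s t, Z (G (s + t)) + G (Z (s + t)) =
      (Z (G s) + G (Z s)) + (Z (G t) + G (Z t)) := by intro s t; simp only [map_add]; abel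
    rw [e4, hH, hH, map_add, hZa, hZa, e1, e2, hHP]
    simp only [add_tmul, tmul_add]
    abel
  · refine ext (f := (Z ∘ₗ G + G ∘ₗ Z) ∘ₗ G - G ∘ₗ (Z ∘ₗ G + G ∘ₗ Z)) (f' := -G) fun v w => ?_
    simp only [LinearMap.comp_apply, LinearMap.add_apply, LinearMap.sub_apply, hH,
      LinearMap.neg_apply]
    have e1 := sub_eq_iff_eq_add.mp (a.Hg v)
    have e2 := sub_eq_iff_eq_add.mp (b.Hg w)
    rw [hGa]
    have e4 : ∀ s t, Z (G (s + t)) + G (Z (s + t)) =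
      (Z (G s) + G (Z s)) + (Z (G t) + G (Z t)) := by intro s t; simp only [map_add]; abel
    rw [e4, hH, hH, map_add, hGa, hGa, e1, e2, hHP]
    simp only [add_tmul, tmul_add, neg_tmul, tmul_neg]
    abel
  · set T : Submodule k (V ⊗[k] W) := _
    change T = ⊤
    rw [eq_top_iff, ← TensorProduct.span_tmul_eq_top, Submodule.span_le]
    rintro _ ⟨v, w, rfl⟩
    have hv : v ∈ Submodule.span k {v | ∃ μ : k, x (g v) + g (x v) = μ • v} := by
      rw [a.Hspan]; trivial
    have hw : w ∈ Submodule.span k {v | ∃ μ : k, y (h v) + h (y v) = μ • v} := by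
      rw [b.Hspan]; trivial
    rw [SetLike.mem_coe]
    induction hv using Submodule.span_induction with
    | zero => simp
    | add v v' _ _ h1 h2 => rw [add_tmul]; exact T.add_mem h1 h2
    | smul c v _ h1 => rw [← smul_tmul']; exact T.smul_mem _ h1
    | mem v hv =>
      induction hw using Submodule.span_induction with
      | zero => simp
      | add v v' _ _ h1 h2 => rw [tmul_add]; exact T.add_mem h1 h2
      | smul c v _ h1 => rw [tmul_smul]; exact T.smul_mem _ h1
      | mem w hw =>
        obtain ⟨μ, hμ⟩ := hv
        obtain ⟨ν, hν⟩ := hw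
        refine Submodule.subset_span ⟨μ + ν, ?_⟩
        rw [hH, hμ, hν, tmul_smul, ← smul_tmul', add_smul]

end tens

section parity
variable {k : Type*} [Field k] [CharZero k] {V : Type*} [AddCommGroup V] [Module k V]
  {V0 V1 : Submodule k V}

theorem parity_iff (hsup : V0 ⊔ V1 = ⊤) {P : V →ₗ[k] V} (h0 : ∀ v ∈ V0, P v = v)
    (h1 : ∀ v ∈ V1, P v = -v) :
    (∀ v, v ∈ V0 ↔ P v = v) ∧ (∀ v, v ∈ V1 ↔ P v = -v) ∧ ∀ v, P (P v) = v := by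
  have key : ∀ v, ∃ a ∈ V0, ∃ c ∈ V1, a + c = v := fun v =>
    Submodule.mem_sup.mp (by rw [hsup]; trivial)
  have two : ∀ w : V, w = -w → w = 0 := fun w hw => by
    have : (2 : k) • w = 0 := by rw [two_smul]; nth_rw 1 [hw]; simp
    exact (smul_eq_zero.mp this).resolve_left two_ne_zero
  refine ⟨fun v => ⟨h0 v, fun hv => ?_⟩, fun v => ⟨h1 v, fun hv => ?_⟩, fun v => ?_⟩
  · obtain ⟨a, ha, c, hc, rfl⟩ := key v
    rw [map_add, h0 a ha, h1 c hc] at hv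
    rw [two c (add_left_cancel hv).symm, add_zero]; exact ha
  · obtain ⟨a, ha, c, hc, rfl⟩ := key v
    rw [map_add, h0 a ha, h1 c hc, neg_add] at hv
    rw [two a (add_right_cancel hv), zero_add]; exact hc
  · obtain ⟨a, ha, c, hc, rfl⟩ := key v
    simp [h0 a ha, h1 c hc]

theorem exists_parity (hc : IsCompl V0 V1) :
    ∃ P : V →ₗ[k] V, (∀ v ∈ V0, P v = v) ∧ (∀ v ∈ V1, P v = -v) := by
  refine ⟨LinearMap.ofIsCompl hc V0.subtype (-V1.subtype), ?_, ?_⟩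
  · intro v hv
    exact LinearMap.ofIsCompl_apply_left hc ⟨v, hv⟩
  · intro v hv
    exact LinearMap.ofIsCompl_apply_right hc ⟨v, hv⟩

end parity
end NeatAux


/-- **Neat pairs are closed under tensor products**: if `(V, x)` and `(W, y)` are neat pairs of
vector superspaces with odd nilpotent endomorphisms over a field of characteristic zero, then
the tensor product pair `(V ⊗ W, x ⊗ 1 + 1 ⊗ y)` (with super sign) is neat; in particular the
tensor product endomorphism is nilpotent. -/
theorem isNeat_tensor {k : Type*} [Field k] [CharZero k]
    (V : Type*) [AddCommGroup V] [Module k V] [FiniteDimensional k V]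
    (V0 V1 : Submodule k V) (hcV : IsCompl V0 V1)
    (x : V →ₗ[k] V) (hxodd : IsOddMap k V0 V1 x) (hxnil : IsNilpotent x)
    (hxneat : IsNeat k V0 V1 x)
    (W : Type*) [AddCommGroup W] [Module k W] [FiniteDimensional k W]
    (W0 W1 : Submodule k W) (hcW : IsCompl W0 W1)
    (y : W →ₗ[k] W) (hyodd : IsOddMap k W0 W1 y) (hynil : IsNilpotent y)
    (hyneat : IsNeat k W0 W1 y)
    (z : V ⊗[k] W →ₗ[k] V ⊗[k] W)
    (hz : IsSuperTensorMap k V0 V1 x y z) :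
    IsNilpotent z ∧ IsNeat k (tensorEven k V0 V1 W0 W1) (tensorOdd k V0 V1 W0 W1) z := by
  obtain ⟨P, hP0, hP1⟩ := NeatAux.exists_parity hcV
  obtain ⟨Q, hQ0, hQ1⟩ := NeatAux.exists_parity hcW
  obtain ⟨pV0, pV1, hPP⟩ := NeatAux.parity_iff hcV.sup_eq_top hP0 hP1
  obtain ⟨pW0, pW1, hQQ⟩ := NeatAux.parity_iff hcW.sup_eq_top hQ0 hQ1
  obtain ⟨m, s, ε, b, hb⟩ := NeatAux.exists_strBasis pV0 pV1 hxneat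
  obtain ⟨m', s', ε', b', hb'⟩ := NeatAux.exists_strBasis pW0 pW1 hyneat
  obtain ⟨g, hg⟩ := hb.exists_osp hxnil
  obtain ⟨g', hg'⟩ := hb'.exists_osp hynil
  have hdecV : ∀ v, ∃ a ∈ V0, ∃ c ∈ V1, a + c = v := fun v =>
    Submodule.mem_sup.mp (by rw [hcV.sup_eq_top]; trivial)
  have hdecW : ∀ v, ∃ a ∈ W0, ∃ c ∈ W1, a + c = v := fun v =>
    Submodule.mem_sup.mp (by rw [hcW.sup_eq_top]; trivial)
  have hzeq : z = TensorProduct.map x LinearMap.id + TensorProduct.map P y := by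
    apply TensorProduct.ext'
    intro v w
    obtain ⟨a, ha, c, hc, rfl⟩ := hdecV v
    rw [TensorProduct.add_tmul, map_add, map_add, hz.1 a ha w, hz.2 c hc w]
    simp [hP0 a ha, hP1 c hc, TensorProduct.neg_tmul, sub_eq_add_neg]
  have hO := hg.tensor hg'
  rw [← hzeq] at hO
  obtain ⟨M, S, E, B, hB⟩ := hO.exists_strBasis
  have hsup : tensorEven k V0 V1 W0 W1 ⊔ tensorOdd k V0 V1 W0 W1 = ⊤ := by
    rw [eq_top_iff, ← TensorProduct.span_tmul_eq_top, Submodule.span_le]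
    rintro _ ⟨v, w, rfl⟩
    obtain ⟨a, ha, c, hc, rfl⟩ := hdecV v
    obtain ⟨a', ha', c', hc', rfl⟩ := hdecW w
    rw [TensorProduct.add_tmul, TensorProduct.tmul_add, TensorProduct.tmul_add]
    refine Submodule.add_mem _ (Submodule.add_mem _ (Submodule.mem_sup_left ?_)
      (Submodule.mem_sup_right ?_)) (Submodule.add_mem _ (Submodule.mem_sup_right ?_)
      (Submodule.mem_sup_left ?_))
    · exact Submodule.subset_span (Or.inl ⟨a, ha, a', ha', rfl⟩)
    · exact Submodule.subset_span (Or.inl ⟨a, ha, c', hc', rfl⟩)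
    · exact Submodule.subset_span (Or.inr ⟨c, hc, a', ha', rfl⟩)
    · exact Submodule.subset_span (Or.inr ⟨c, hc, c', hc', rfl⟩)
  have hE : ∀ t ∈ tensorEven k V0 V1 W0 W1, TensorProduct.map P Q t = t := by
    intro t ht
    have : tensorEven k V0 V1 W0 W1 ≤
        LinearMap.eqLocus (TensorProduct.map P Q) LinearMap.id := by
      refine Submodule.span_le.mpr ?_
      rintro _ (⟨v, hv, w, hw, rfl⟩ | ⟨v, hv, w, hw, rfl⟩)
      · simp [hP0 v hv, hQ0 w hw]
      · simp [hP1 v hv, hQ1 w hw, TensorProduct.neg_tmul, TensorProduct.tmul_neg]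
    exact this ht
  have hOd : ∀ t ∈ tensorOdd k V0 V1 W0 W1, TensorProduct.map P Q t = -t := by
    intro t ht
    have : tensorOdd k V0 V1 W0 W1 ≤
        LinearMap.eqLocus (TensorProduct.map P Q) (-LinearMap.id) := by
      refine Submodule.span_le.mpr ?_
      rintro _ (⟨v, hv, w, hw, rfl⟩ | ⟨v, hv, w, hw, rfl⟩)
      · simp [hP0 v hv, hQ1 w hw, TensorProduct.tmul_neg]
      · simp [hP1 v hv, hQ0 w hw, TensorProduct.neg_tmul]
    exact this ht
  obtain ⟨q0, q1, hqq⟩ := NeatAux.parity_iff hsup hE hOd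
  exact ⟨hO.xnil, hB.isNeat hqq q0 q1⟩
end
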